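/- arXiv:1509.03618 — 4 statements merged into one kernel-verified Lean document; each statement's English description precedes it below -/
import Mathlib

section
/- For every ring R and every natural number n ≥ 3, the matrix ring Mₙ(R) = Matrix (Fin n) (Fin n) R has no prime partial ideal. -/
/-- A prime partial ideal of a ring `R`: a subset `p ⊆ R` such that for every subring `C` of
`R` whose multiplication is commutative, the set `{x : C | (x : R) ∈ p}` is a prime ideal of
`C`. -/
def IsPrimePartialIdeal {R : Type*} [Ring R] (p : Set R) : Prop :=
  ∀ C : Subring R, (∀ x y : C, x * y = y * x) →
    ∃ I : Ideal C, I.IsPrime ∧ ∀ x : C, x ∈ I ↔ (x : R) ∈ p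

namespace IsPrimePartialIdeal

variable {A : Type*} [Ring A] {p : Set A}

theorem exists_ideal_of_commute (hp : IsPrimePartialIdeal p) {x y : A} (h : Commute x y) :
    ∃ (C : Subring A) (I : Ideal C), x ∈ C ∧ y ∈ C ∧ I.IsPrime ∧
      ∀ z : C, z ∈ I ↔ (z : A) ∈ p := by
  have hcomm : ∀ a ∈ ({x, y} : Set A), ∀ b ∈ ({x, y} : Set A), a * b = b * a := by
    rintro a (rfl | rfl) b (rfl | rfl)
    exacts [rfl, h.eq, h.eq.symm, rfl]
  obtain ⟨I, hI, hIp⟩ := hp (Subring.closure {x, y})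
    (Subring.isMulCommutative_closure hcomm).is_comm.comm
  exact ⟨_, I, Subring.subset_closure (by simp), Subring.subset_closure (by simp), hI, hIp⟩

theorem one_notMem (hp : IsPrimePartialIdeal p) : (1 : A) ∉ p := by
  obtain ⟨C, I, -, -, hI, hIp⟩ := hp.exists_ideal_of_commute (Commute.refl (1 : A))
  exact fun h => hI.ne_top ((Ideal.eq_top_iff_one I).2 ((hIp 1).2 h))

theorem zero_mem (hp : IsPrimePartialIdeal p) : (0 : A) ∈ p := by
  obtain ⟨C, I, -, -, -, hIp⟩ := hp.exists_ideal_of_commute (Commute.refl (1 : A))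
  exact (hIp 0).1 I.zero_mem

theorem add_mem (hp : IsPrimePartialIdeal p) {x y : A} (h : Commute x y) (hx : x ∈ p)
    (hy : y ∈ p) : x + y ∈ p := by
  obtain ⟨C, I, hxC, hyC, -, hIp⟩ := hp.exists_ideal_of_commute h
  exact (hIp (⟨x, hxC⟩ + ⟨y, hyC⟩)).1 (I.add_mem ((hIp _).2 hx) ((hIp _).2 hy))

theorem mul_mem_left (hp : IsPrimePartialIdeal p) {x y : A} (h : Commute x y) (hy : y ∈ p) :
    x * y ∈ p := by
  obtain ⟨C, I, hxC, hyC, -, hIp⟩ := hp.exists_ideal_of_commute h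
  exact (hIp (⟨x, hxC⟩ * ⟨y, hyC⟩)).1 (I.mul_mem_left _ ((hIp _).2 hy))

theorem mem_or_mem_of_mul_eq_zero (hp : IsPrimePartialIdeal p) {x y : A} (hxy : x * y = 0)
    (hyx : y * x = 0) : x ∈ p ∨ y ∈ p := by
  obtain ⟨C, I, hxC, hyC, hI, hIp⟩ := hp.exists_ideal_of_commute (hxy.trans hyx.symm)
  have h : (⟨x, hxC⟩ * ⟨y, hyC⟩ : C) = 0 := Subtype.ext hxy
  exact (hI.mem_or_mem_of_mul_eq_zero h).imp (hIp _).1 (hIp _).1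

theorem sum_mem (hp : IsPrimePartialIdeal p) {ι : Type*} (s : Finset ι) (f : ι → A)
    (hc : ∀ i j, Commute (f i) (f j)) (hf : ∀ i ∈ s, f i ∈ p) : ∑ i ∈ s, f i ∈ p := by
  classical
  induction s using Finset.induction_on with
  | empty => simpa using hp.zero_mem
  | insert i s hi ih =>
    rw [Finset.sum_insert hi]
    exact hp.add_mem (Commute.sum_right _ _ _ fun j _ => hc i j) (hf i (by simp))
      (ih fun j hj => hf j (by simp [hj]))

end IsPrimePartialIdeal

/-- `c v f` holds for exactly one of the pairs `(v₁, f₁)`, `(v₂, f₂)`, `(v₃, f₃)` whenever the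
`vᵢ` form a basis of `ℤ³` with dual basis `fᵢ`. -/
def IsDualBasisColoring (c : (Fin 3 → ℤ) → (Fin 3 → ℤ) → Prop) : Prop :=
  ∀ v₁ v₂ v₃ f₁ f₂ f₃ : Fin 3 → ℤ,
    (Matrix.of ![f₁, f₂, f₃]) * (Matrix.of ![v₁, v₂, v₃]).transpose = 1 →
      (c v₁ f₁ ∨ c v₂ f₂ ∨ c v₃ f₃) ∧
        ¬ (c v₁ f₁ ∧ c v₂ f₂) ∧ ¬ (c v₁ f₁ ∧ c v₃ f₃) ∧ ¬ (c v₂ f₂ ∧ c v₃ f₃)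

/-- A Kochen–Specker theorem for `ℤ³`: a finite set of dual bases admits no colouring. -/
theorem not_isDualBasisColoring (c : (Fin 3 → ℤ) → (Fin 3 → ℤ) → Prop) :
    ¬ IsDualBasisColoring c := by
  intro h
  have := h ![1, 1, -1] ![1, 0, -1] ![0, 1, -1]
    ![1, 1, 1] ![0, -1, -1] ![-1, 0, -1] (by decide)
  have := h ![1, 1, -1] ![0, 1, 0] ![0, 1, -1]
    ![1, 0, 0] ![0, 1, 1] ![-1, 0, -1] (by decide)
  have := h ![1, 1, -1] ![0, 1, -1] ![0, 0, 1]
    ![1, 0, 0] ![-1, 1, 0] ![0, 1, 1] (by decide)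
  have := h ![1, 0, 1] ![1, 0, 0] ![1, -1, 1]
    ![0, 1, 1] ![1, 0, -1] ![0, -1, 0] (by decide)
  have := h ![1, 0, 1] ![1, 0, 0] ![1, -1, 0]
    ![0, 0, 1] ![1, 1, -1] ![0, -1, 0] (by decide)
  have := h ![1, 0, 1] ![1, 0, 0] ![0, 1, 0]
    ![0, 0, 1] ![1, 0, -1] ![0, 1, 0] (by decide)
  have := h ![1, 0, 0] ![1, 0, -1] ![1, -1, 0]
    ![1, 1, 1] ![0, 0, -1] ![0, -1, 0] (by decide)
  have := h ![1, 0, 0] ![1, 0, -1] ![0, 1, -1]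
    ![1, 1, 1] ![0, -1, -1] ![0, 1, 0] (by decide)
  have := h ![1, 0, 0] ![1, -1, 0] ![0, 1, -1]
    ![1, 1, 1] ![0, -1, -1] ![0, 0, -1] (by decide)
  have := h ![1, 0, 0] ![1, -1, 1] ![1, -1, 0]
    ![1, 1, 0] ![0, 0, 1] ![0, -1, -1] (by decide)
  have := h ![1, 0, 0] ![1, -1, 1] ![0, 0, 1]
    ![1, 1, 0] ![0, -1, 0] ![0, 1, 1] (by decide)
  have := h ![1, 0, 0] ![1, -1, 0] ![0, 0, 1]
    ![1, 1, 0] ![0, -1, 0] ![0, 0, 1] (by decide)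
  have := h ![1, 0, 0] ![1, 0, -1] ![0, 1, 0]
    ![1, 0, 1] ![0, 0, -1] ![0, 1, 0] (by decide)
  have := h ![1, 0, 0] ![1, -1, -1] ![0, 1, 0]
    ![1, 0, 1] ![0, 0, -1] ![0, 1, -1] (by decide)
  have := h ![1, 0, 0] ![0, 1, 0] ![0, 1, -1]
    ![1, 0, 0] ![0, 1, 1] ![0, 0, -1] (by decide)
  have := h ![1, 0, 0] ![0, 1, 0] ![0, 0, 1]
    ![1, 0, 0] ![0, 1, 0] ![0, 0, 1] (by decide)
  have := h ![1, 0, 0] ![0, 1, -1] ![0, 0, 1]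
    ![1, 0, 0] ![0, 1, 0] ![0, 1, 1] (by decide)
  have := h ![1, 0, -1] ![1, -1, 0] ![1, -1, -1]
    ![1, 1, 0] ![1, 0, 1] ![-1, -1, -1] (by decide)
  have := h ![1, 0, -1] ![1, -1, 0] ![0, 0, 1]
    ![1, 1, 0] ![0, -1, 0] ![1, 1, 1] (by decide)
  have := h ![1, 0, -1] ![1, -1, -1] ![0, 0, 1]
    ![1, 1, 0] ![0, -1, 0] ![1, 0, 1] (by decide)
  have := h ![1, 0, -1] ![0, 1, 1] ![0, 1, 0]
    ![1, 0, 0] ![1, 0, 1] ![-1, 1, -1] (by decide)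
  have := h ![1, 0, -1] ![0, 1, 0] ![0, 0, 1]
    ![1, 0, 0] ![0, 1, 0] ![1, 0, 1] (by decide)
  have := h ![1, 0, -1] ![0, 1, -1] ![0, 0, 1]
    ![1, 0, 0] ![0, 1, 0] ![1, 1, 1] (by decide)
  have := h ![1, 0, -1] ![1, -1, 0] ![0, 1, 0]
    ![0, 0, -1] ![1, 0, 1] ![1, 1, 1] (by decide)
  have := h ![1, -1, 1] ![1, -1, 0] ![0, 1, -1]
    ![1, 1, 1] ![0, -1, -1] ![1, 1, 0] (by decide)
  have := h ![1, -1, 0] ![1, -1, -1] ![0, 1, 0]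
    ![1, 0, 1] ![0, 0, -1] ![1, 1, 0] (by decide)
  have := h ![1, -1, 0] ![0, 1, 0] ![0, 1, -1]
    ![1, 0, 0] ![1, 1, 1] ![0, 0, -1] (by decide)
  have := h ![1, -1, 0] ![0, 1, 0] ![0, 0, 1]
    ![1, 0, 0] ![1, 1, 0] ![0, 0, 1] (by decide)
  have := h ![1, -1, 0] ![0, 1, -1] ![0, 0, 1]
    ![1, 0, 0] ![1, 1, 0] ![1, 1, 1] (by decide)
  have := h ![1, -1, -1] ![0, 1, 1] ![0, 1, 0]
    ![1, 0, 0] ![1, 0, 1] ![0, 1, -1] (by decide)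
  have := h ![1, -1, -1] ![0, 1, 0] ![0, 0, 1]
    ![1, 0, 0] ![1, 1, 0] ![1, 0, 1] (by decide)
  grind

theorem isDualBasisColoring_of_nonUnitalRingHom {A : Type*} [Ring A] {p : Set A}
    (hp : IsPrimePartialIdeal p) (φ : Matrix (Fin 3) (Fin 3) ℤ →ₙ+* A) (hφ : φ 1 ∉ p) :
    IsDualBasisColoring fun v f => φ (Matrix.vecMulVec v f) ∉ p := by
  intro v₁ v₂ v₃ f₁ f₂ f₃ h
  set U := (Matrix.of ![v₁, v₂, v₃]).transpose
  set V := Matrix.of ![f₁, f₂, f₃]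
  let e : Fin 3 → Matrix (Fin 3) (Fin 3) ℤ := fun i =>
    Matrix.vecMulVec (U.transpose i) (V i)
  have hmul : ∀ i j, i ≠ j → φ (e i) * φ (e j) = 0 := fun i j hij => by
    have h0 : V i ⬝ᵥ U.transpose j = 0 := by
      simpa [Matrix.mul_apply, Matrix.one_apply_ne hij, dotProduct] using congrFun₂ h i j
    rw [← map_mul, Matrix.vecMulVec_mul_vecMulVec, h0]
    simp
  have hcomm : ∀ i j, Commute (φ (e i)) (φ (e j)) := fun i j => by
    rcases eq_or_ne i j with rfl | hij
    · exact Commute.refl _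
    · exact (hmul i j hij).trans (hmul j i hij.symm).symm
  have hpair : ∀ i j, i ≠ j → ¬ (φ (e i) ∉ p ∧ φ (e j) ∉ p) := fun i j hij => by
    have := hp.mem_or_mem_of_mul_eq_zero (hmul i j hij) (hmul j i hij.symm)
    tauto
  have hsum : ∑ i, e i = 1 := by
    rw [← mul_eq_one_comm.1 h]
    ext i j
    simp [e, Matrix.sum_apply, Matrix.vecMulVec_apply, Matrix.mul_apply]
  refine ⟨?_, hpair 0 1 (by decide), hpair 0 2 (by decide), hpair 1 2 (by decide)⟩
  by_contra! hmem
  refine hφ ?_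
  rw [← hsum, map_sum]
  refine hp.sum_mem _ _ hcomm fun i _ => ?_
  fin_cases i
  exacts [hmem.1, hmem.2.1, hmem.2.2]

/-- The non-unital embedding of `M_m(ℤ)` in `M_n(R)` along an injection of index types. -/
def Matrix.cornerHom (R : Type*) [Ring R] {m n : Type*} [Fintype m] [DecidableEq m]
    [Fintype n] [DecidableEq n] (g : m ↪ n) : Matrix m m ℤ →ₙ+* Matrix n n R where
  toFun M := (1 : Matrix n n R).submatrix id g * M.map (Int.cast : ℤ → R) *
    (1 : Matrix n n R).submatrix g id
  map_zero' := by simp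
  map_add' M N := by
    rw [Matrix.map_add _ Int.cast_add, Matrix.mul_add, Matrix.add_mul]
  map_mul' M N := by
    have h : (1 : Matrix n n R).submatrix g id * (1 : Matrix n n R).submatrix id g = 1 := by
      rw [← Matrix.submatrix_mul _ _ _ _ _ Function.bijective_id, Matrix.one_mul,
        Matrix.submatrix_one_embedding]
    have hMN : (M * N).map (Int.cast : ℤ → R) = M.map Int.cast * N.map Int.cast :=
      Matrix.map_mul (f := Int.castRingHom R)
    rw [hMN]
    simp only [Matrix.mul_assoc]
    rw [← Matrix.mul_assoc (submatrix 1 g id), h, Matrix.one_mul]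

theorem Matrix.cornerHom_single (R : Type*) [Ring R] {m n : Type*} [Fintype m] [DecidableEq m]
    [Fintype n] [DecidableEq n] (g : m ↪ n) (i : m) :
    Matrix.cornerHom R g (Matrix.single i i 1) = Matrix.single (g i) (g i) 1 := by
  have hmap : (Matrix.single i i (1 : ℤ)).map (Int.cast : ℤ → R) = Matrix.single i i 1 := by
    ext a b
    simp [Matrix.single_apply]
  change (1 : Matrix n n R).submatrix id g * (Matrix.single i i (1 : ℤ)).map (Int.cast : ℤ → R) *
    (1 : Matrix n n R).submatrix g id = _
  rw [hmap, Matrix.single_eq_single_vecMulVec_single, Matrix.mul_vecMulVec,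
    Matrix.vecMulVec_mul, Matrix.single_eq_single_vecMulVec_single]
  ext a b
  simp [Matrix.vecMulVec_apply, Matrix.one_apply, Pi.single_apply, eq_comm]

theorem IsPrimePartialIdeal.exists_single_notMem {R n : Type*} [Ring R] [Fintype n]
    [DecidableEq n] {p : Set (Matrix n n R)} (hp : IsPrimePartialIdeal p) :
    ∃ i, Matrix.single i i 1 ∉ p := by
  by_contra! h
  refine hp.one_notMem ?_
  rw [← Matrix.sum_single_one]
  refine hp.sum_mem _ _ (fun i j => ?_) fun i _ => h i
  rcases eq_or_ne i j with rfl | hij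
  · exact Commute.refl _
  · simp [Commute, SemiconjBy, Matrix.single_mul_single_of_ne, hij, hij.symm]

/-- For every ring `R` and every `n ≥ 3`, the matrix ring `Mₙ(R)` has no prime partial
ideal. -/
theorem no_prime_partial_ideal_matrix_ring (R : Type*) [Ring R] (n : ℕ) (hn : 3 ≤ n) :
    ¬ ∃ p : Set (Matrix (Fin n) (Fin n) R), IsPrimePartialIdeal p := by
  rintro ⟨p, hp⟩
  obtain ⟨i, hi⟩ := hp.exists_single_notMem
  let g : Fin 3 ↪ Fin n :=
    (Fin.castLEEmb hn).trans (Equiv.swap (Fin.castLEEmb hn 0) i).toEmbedding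
  have hg : g 0 = i := by simp [g]
  refine not_isDualBasisColoring _
    (isDualBasisColoring_of_nonUnitalRingHom hp (Matrix.cornerHom R g) fun h => hi ?_)
  have hcomm : Commute (Matrix.cornerHom R g (Matrix.single 0 0 1)) (Matrix.cornerHom R g 1) := by
    simp [Commute, SemiconjBy, ← map_mul]
  rw [← hg, ← Matrix.cornerHom_single]
  simpa [← map_mul] using hp.mul_mem_left hcomm h
end

section
/- For p = 2 and for p = 3, there exists a morphism of partial rings from the partial ring M₃(ℤ)_sym of symmetric 3×3 integer matrices to the finite field 𝔽_{p⁶} = GaloisField p 6: a function f, defined on {A : Matrix (Fin 3) (Fin 3) ℤ | Aᵀ = A} with values in GaloisField p 6, such that f 0 = 0, f 1 = 1, and for all symmetric A, B with A * B = B * A one has f (A + B) = f A + f B and f (A * B) = f A * f B. Consequently, the partial ring M₃(ℤ)_sym has a prime partial ideal. -/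
open Matrix

/-- A Kochen–Specker coloring of the symmetric idempotents of `M₃(R)`. -/
def IsSymKSColoring {R : Type*} [CommRing R]
    (c : {P : Matrix (Fin 3) (Fin 3) R // Pᵀ = P ∧ P * P = P} → Bool) : Prop :=
  ∀ (k : ℕ) (e : Fin k → {P : Matrix (Fin 3) (Fin 3) R // Pᵀ = P ∧ P * P = P}),
    (∀ i j : Fin k, i ≠ j →
      (e i : Matrix (Fin 3) (Fin 3) R) * (e j : Matrix (Fin 3) (Fin 3) R) = 0) →
    ((∀ i j : Fin k, c (e i) = true → c (e j) = true → i = j) ∧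
      ((∑ i, (e i : Matrix (Fin 3) (Fin 3) R)) = 1 → ∃! i : Fin k, c (e i) = true))

/-- A prime partial ideal of the partial ring `M₃(R)_sym` of symmetric matrices: a subset
of the set of symmetric matrices such that for every commutative subring `C` of `M₃(R)`
consisting of symmetric matrices, the corresponding subset of `C` is a prime ideal. -/
def IsSymPrimePartialIdeal {R : Type*} [CommRing R]
    (p : Set (Matrix (Fin 3) (Fin 3) R)) : Prop :=
  (∀ A ∈ p, Aᵀ = A) ∧
  ∀ C : Subring (Matrix (Fin 3) (Fin 3) R), (∀ x y : C, x * y = y * x) →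
    (∀ x : C, (x : Matrix (Fin 3) (Fin 3) R)ᵀ = (x : Matrix (Fin 3) (Fin 3) R)) →
    ∃ I : Ideal C, I.IsPrime ∧ ∀ x : C, x ∈ I ↔ (x : Matrix (Fin 3) (Fin 3) R) ∈ p

/-- A morphism of partial rings from the partial ring of symmetric `3 × 3` matrices over a
commutative ring `R` to a commutative ring `K`: it preserves `0` and `1`, and preserves
sums and products of commuting symmetric matrices. -/
def IsSymPartialRingHom {R K : Type*} [CommRing R] [CommRing K]
    (f : {A : Matrix (Fin 3) (Fin 3) R // Aᵀ = A} → K) : Prop :=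
  f ⟨0, Matrix.transpose_zero⟩ = 0 ∧
  f ⟨1, Matrix.transpose_one⟩ = 1 ∧
  ∀ (A B : {A : Matrix (Fin 3) (Fin 3) R // Aᵀ = A})
    (h : (A : Matrix (Fin 3) (Fin 3) R) * B = (B : Matrix (Fin 3) (Fin 3) R) * A),
    f ⟨(A : Matrix (Fin 3) (Fin 3) R) + B,
        by rw [Matrix.transpose_add, A.2, B.2]⟩ = f A + f B ∧
    f ⟨(A : Matrix (Fin 3) (Fin 3) R) * B,
        by rw [Matrix.transpose_mul, B.2, A.2]; exact h.symm⟩ = f A * f B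

open Polynomial

/-- Symmetric `3 × 3` matrices, with rows `(a, d, e)`, `(d, b, f)`, `(e, f, c)`. -/
@[ext] structure Sym3 (k : Type*) where
  (a b c d e f : k)

namespace Sym3

/- Only the bare operations are assumed here, so that over `ZMod n` everything can be evaluated
with the operations of `Fin n`. -/
section Operations

variable {k : Type*} [Add k] [Mul k] [Sub k] [Zero k]

/-- The sum of two symmetric matrices. -/
def add (A B : Sym3 k) : Sym3 k :=
  ⟨A.a + B.a, A.b + B.b, A.c + B.c, A.d + B.d, A.e + B.e, A.f + B.f⟩

/-- The upper triangle of the product of two symmetric matrices. -/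
def mul (A B : Sym3 k) : Sym3 k where
  a := A.a * B.a + A.d * B.d + A.e * B.e
  b := A.d * B.d + A.b * B.b + A.f * B.f
  c := A.e * B.e + A.f * B.f + A.c * B.c
  d := A.a * B.d + A.d * B.b + A.e * B.f
  e := A.a * B.e + A.d * B.f + A.e * B.c
  f := A.d * B.e + A.b * B.f + A.f * B.c

/-- The scalar multiple `x A`. -/
def smul (x : k) (A : Sym3 k) : Sym3 k :=
  ⟨x * A.a, x * A.b, x * A.c, x * A.d, x * A.e, x * A.f⟩

/-- The matrix `A + t`. -/
def addScalar (A : Sym3 k) (t : k) : Sym3 k :=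
  ⟨A.a + t, A.b + t, A.c + t, A.d, A.e, A.f⟩

/-- The matrix `x A² + y A + z`. -/
def quad (A : Sym3 k) (x y z : k) : Sym3 k :=
  (((A.mul A).smul x).add (A.smul y)).addScalar z

/-- `A` and `B` commute. -/
def Comm (A B : Sym3 k) : Prop :=
  (A.mul B).d = (B.mul A).d ∧ (A.mul B).e = (B.mul A).e ∧ (A.mul B).f = (B.mul A).f

/-- The trace. -/
def tr (A : Sym3 k) : k := A.a + A.b + A.c

/-- The sum of the principal `2 × 2` minors. -/
def minors (A : Sym3 k) : k :=
  (A.a * A.b - A.d * A.d) + (A.a * A.c - A.e * A.e) + (A.b * A.c - A.f * A.f)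

/-- The determinant. -/
def det (A : Sym3 k) : k :=
  A.a * (A.b * A.c - A.f * A.f) - A.d * (A.d * A.c - A.f * A.e) + A.e * (A.d * A.f - A.b * A.e)

/-- `r` is a root of the characteristic polynomial. -/
def IsEigenvalue (A : Sym3 k) (r : k) : Prop :=
  r * r * r + A.minors * r = A.tr * (r * r) + A.det

/-- The determinant of the matrix with rows `w`, `A w`, `A² w`, where `w = (x, y, z)`. -/
def krylovDet (A : Sym3 k) (x y z : k) : k :=
  let x₁ := A.a * x + A.d * y + A.e * z
  let y₁ := A.d * x + A.b * y + A.f * z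
  let z₁ := A.e * x + A.f * y + A.c * z
  let x₂ := A.a * x₁ + A.d * y₁ + A.e * z₁
  let y₂ := A.d * x₁ + A.b * y₁ + A.f * z₁
  let z₂ := A.e * x₁ + A.f * y₁ + A.c * z₁
  x * (y₁ * z₂ - z₁ * y₂) - y * (x₁ * z₂ - z₁ * x₂) + z * (x₁ * y₂ - y₁ * x₂)

/-- `A` has rank at most one. -/
def IsRankOne (A : Sym3 k) : Prop :=
  A.a * A.b = A.d * A.d ∧ A.a * A.c = A.e * A.e ∧ A.b * A.c = A.f * A.f ∧
  A.a * A.f = A.d * A.e ∧ A.b * A.e = A.d * A.f ∧ A.c * A.d = A.e * A.f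

/-- The function on matrices of rank at most one whose restriction to the idempotents is, over
`𝔽₂` and `𝔽₃`, a Kochen–Specker coloring. -/
def value (A : Sym3 k) : k := (A.a + A.d + A.e) * (A.tr * A.tr)

/-- `A` is the sum of a scalar and a matrix of rank at most one. -/
def IsDegenerate (A : Sym3 k) : Prop := ∃ t, (A.addScalar t).IsRankOne

/-- Evaluation at some eigenvalue in `k` is compatible with `value`. -/
def HasRationalPoint (A : Sym3 k) : Prop :=
  ∃ r, A.IsEigenvalue r ∧
    ∀ x y z, (A.quad x y z).IsRankOne → x * (r * r) + y * r + z = (A.quad x y z).value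

/-- For some eigenvalue `r` in `k`, evaluation at the other two eigenvalues is compatible with
`value`. -/
def HasQuadraticPoint (A : Sym3 k) : Prop :=
  ∃ r, A.IsEigenvalue r ∧
    ∀ x y z, (A.quad x y z).IsRankOne → x * (A.tr - r) + y = 0 ∧
      x * (r * (A.tr - r) - A.minors) + z = (A.quad x y z).value

/-- Evaluation at any eigenvalue is compatible with `value`. -/
def HasCubicPoint (A : Sym3 k) : Prop :=
  ∀ x y z, (A.quad x y z).IsRankOne → x = 0 ∧ y = 0 ∧ z = (A.quad x y z).value

/-- Either `A` is degenerate, or it has a cyclic vector and `value` extends to a homomorphism on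
the algebra generated by `A`. -/
def Extends (A : Sym3 k) : Prop :=
  A.IsDegenerate ∨ (∃ x y z, A.krylovDet x y z ≠ 0) ∧
    (A.HasRationalPoint ∨ A.HasQuadraticPoint ∨ A.HasCubicPoint)

/-- `value` is compatible with the sums and products of `A` and `B` up to scalars. -/
def Compatible (A B : Sym3 k) : Prop :=
  (∀ u, ((A.add B).addScalar u).IsRankOne →
    ((A.add B).addScalar u).value = A.value + B.value + u) ∧
  (∀ s t u, (((A.addScalar s).mul (B.addScalar t)).addScalar u).IsRankOne →
    (((A.addScalar s).mul (B.addScalar t)).addScalar u).value =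
      (A.value + s) * (B.value + t) + u)

variable (k) in
/-- Every symmetric matrix with last entry zero satisfies `Extends`. -/
def AllExtend : Prop := ∀ a b d e f : k, (mk a b 0 d e f).Extends

variable (k) in
/-- Commuting symmetric matrices of rank at most one are `Compatible`. -/
def AllCompatible : Prop :=
  ∀ a b c d e f : k, (mk a b c d e f).IsRankOne → ∀ a' b' c' d' e' f' : k,
    (mk a' b' c' d' e' f').IsRankOne → (mk a b c d e f).Comm (mk a' b' c' d' e' f') →
    (mk a b c d e f).Compatible (mk a' b' c' d' e' f')

section Decidable

variable [DecidableEq k]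

instance (A : Sym3 k) : Decidable A.IsRankOne := by
  unfold IsRankOne; infer_instance

instance (A B : Sym3 k) : Decidable (A.Comm B) := by
  unfold Comm; infer_instance

instance (A : Sym3 k) (r : k) : Decidable (A.IsEigenvalue r) := by
  unfold IsEigenvalue; infer_instance

variable [Fintype k]

instance (A : Sym3 k) : Decidable A.IsDegenerate := by
  unfold IsDegenerate; infer_instance

instance (A : Sym3 k) : Decidable A.HasRationalPoint := by
  unfold HasRationalPoint; infer_instance

instance (A : Sym3 k) : Decidable A.HasQuadraticPoint := by
  unfold HasQuadraticPoint; infer_instance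

instance (A : Sym3 k) : Decidable A.HasCubicPoint := by
  unfold HasCubicPoint; infer_instance

instance (A : Sym3 k) : Decidable A.Extends := by
  unfold Extends; infer_instance

instance (A B : Sym3 k) : Decidable (A.Compatible B) := by
  unfold Compatible; infer_instance

instance : Decidable (AllExtend k) := by
  unfold AllExtend; infer_instance

set_option synthInstance.maxHeartbeats 400000 in
set_option synthInstance.maxSize 4000 in
instance : Decidable (AllCompatible k) := by
  unfold AllCompatible; infer_instance

end Decidable

end Operations

section Matrix

variable {k : Type*}

/-- The matrix represented by an element of `Sym3 k`. -/
def toMatrix (A : Sym3 k) : Matrix (Fin 3) (Fin 3) k :=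
  !![A.a, A.d, A.e; A.d, A.b, A.f; A.e, A.f, A.c]

/-- The upper triangle of a matrix. -/
def ofMatrix (A : Matrix (Fin 3) (Fin 3) k) : Sym3 k :=
  ⟨A 0 0, A 1 1, A 2 2, A 0 1, A 0 2, A 1 2⟩

theorem toMatrix_ofMatrix {A : Matrix (Fin 3) (Fin 3) k} (hA : Aᵀ = A) :
    (ofMatrix A).toMatrix = A := by
  have h (i j) : A i j = A j i := congrFun (congrFun hA j) i
  ext i j
  fin_cases i <;> fin_cases j <;> simp [toMatrix, ofMatrix, h 1 0, h 2 0, h 2 1]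

@[simp] theorem ofMatrix_toMatrix (A : Sym3 k) : ofMatrix A.toMatrix = A := by
  ext <;> simp [toMatrix, ofMatrix]

end Matrix

section CommRing

variable {k : Type*} [CommRing k]

theorem ofMatrix_add (A B : Matrix (Fin 3) (Fin 3) k) :
    ofMatrix (A + B) = (ofMatrix A).add (ofMatrix B) := rfl

theorem ofMatrix_toMatrix_mul (A B : Sym3 k) :
    ofMatrix (A.toMatrix * B.toMatrix) = A.mul B := by
  ext <;> simp [toMatrix, ofMatrix, mul, Matrix.mul_apply, Fin.sum_univ_three]

theorem ofMatrix_quad (A : Sym3 k) (x y z : k) :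
    ofMatrix (x • (A.toMatrix * A.toMatrix) + y • A.toMatrix + z • 1) = A.quad x y z := by
  ext <;> simp [toMatrix, ofMatrix, quad, add, smul, addScalar, mul] <;> ring

theorem comm_of_toMatrix {A B : Sym3 k} (h : A.toMatrix * B.toMatrix = B.toMatrix * A.toMatrix) :
    A.Comm B := by
  have h' := congrArg ofMatrix h
  rw [ofMatrix_toMatrix_mul, ofMatrix_toMatrix_mul] at h'
  simp [Comm, h']

theorem Comm.addScalar {A B : Sym3 k} (h : A.Comm B) (s t : k) :
    (A.addScalar s).Comm (B.addScalar t) := by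
  obtain ⟨h₁, h₂, h₃⟩ := h
  simp only [Comm, mul, Sym3.addScalar] at *
  refine ⟨?_, ?_, ?_⟩
  · linear_combination h₁
  · linear_combination h₂
  · linear_combination h₃

/-- `A = N - t` for some `N` of rank at most one and some scalar `t` with `N.value - t = y`. -/
def HasValue (A : Sym3 k) (y : k) : Prop :=
  ∃ t, (A.addScalar t).IsRankOne ∧ (A.addScalar t).value = y + t

theorem IsDegenerate.exists_hasValue {A : Sym3 k} (h : A.IsDegenerate) : ∃ y, A.HasValue y := by
  obtain ⟨t, ht⟩ := h
  exact ⟨_, t, ht, (sub_add_cancel _ t).symm⟩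

theorem HasValue.isDegenerate {A : Sym3 k} {y : k} (h : A.HasValue y) : A.IsDegenerate :=
  h.imp fun _ ↦ And.left

theorem addScalar_addScalar (A : Sym3 k) (s t : k) :
    (A.addScalar s).addScalar t = A.addScalar (s + t) := by
  ext <;> simp [addScalar, add_assoc]

theorem HasValue.addScalar {A : Sym3 k} {y : k} (h : A.HasValue y) (s : k) :
    (A.addScalar s).HasValue (y + s) := by
  obtain ⟨t, ht, hv⟩ := h
  refine ⟨t - s, ?_, ?_⟩
  · rwa [addScalar_addScalar, add_sub_cancel]
  · rw [addScalar_addScalar, add_sub_cancel, hv]; ring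

theorem hasValue_zero : (ofMatrix (0 : Matrix (Fin 3) (Fin 3) k)).HasValue 0 :=
  ⟨0, by simp [ofMatrix, Sym3.addScalar, IsRankOne], by
    simp [ofMatrix, Sym3.addScalar, value]⟩

theorem hasValue_one : (ofMatrix (1 : Matrix (Fin 3) (Fin 3) k)).HasValue 1 :=
  ⟨-1, by simp [ofMatrix, Sym3.addScalar, IsRankOne], by
    simp [ofMatrix, Sym3.addScalar, value]⟩

theorem quad_addScalar (A : Sym3 k) (x y z t : k) :
    (A.quad x y z).addScalar t = A.quad x y (z + t) :=
  addScalar_addScalar _ _ _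

theorem AllCompatible.compatible (hk : AllCompatible k) {A B : Sym3 k} (hA : A.IsRankOne)
    (hB : B.IsRankOne) (h : A.Comm B) : A.Compatible B :=
  hk _ _ _ _ _ _ hA _ _ _ _ _ _ hB h

theorem HasValue.add (hk : AllCompatible k) {A B : Sym3 k} (h : A.Comm B) {a b c : k}
    (hA : A.HasValue a) (hB : B.HasValue b) (hC : (A.add B).HasValue c) : c = a + b := by
  obtain ⟨s, hs, hsv⟩ := hA
  obtain ⟨t, ht, htv⟩ := hB
  obtain ⟨u, hu, huv⟩ := hC
  have key : ((A.addScalar s).add (B.addScalar t)).addScalar (u - s - t) =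
      (A.add B).addScalar u := by
    ext <;> simp only [Sym3.addScalar, Sym3.add] <;> ring
  have := (hk.compatible hs ht (h.addScalar s t)).1 (u - s - t)
  rw [key] at this
  linear_combination this hu - huv + hsv + htv

theorem HasValue.mul (hk : AllCompatible k) {A B : Sym3 k} (h : A.Comm B) {a b c : k}
    (hA : A.HasValue a) (hB : B.HasValue b) (hC : (A.mul B).HasValue c) : c = a * b := by
  obtain ⟨s, hs, hsv⟩ := hA
  obtain ⟨t, ht, htv⟩ := hB
  obtain ⟨u, hu, huv⟩ := hC
  have key (C : Sym3 k) (s : k) : (C.addScalar s).addScalar (-s) = C := by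
    ext <;> simp [Sym3.addScalar]
  have := (hk.compatible hs ht (h.addScalar s t)).2 (-s) (-t) u
  rw [key, key, hsv, htv] at this
  linear_combination this hu - huv

/-- The characteristic polynomial. -/
noncomputable def charpoly (A : Sym3 k) : k[X] :=
  X ^ 3 - C A.tr * X ^ 2 + C A.minors * X - C A.det

theorem natDegree_charpoly [Nontrivial k] (A : Sym3 k) : A.charpoly.natDegree = 3 := by
  unfold charpoly; compute_degree!

theorem monic_charpoly [Nontrivial k] (A : Sym3 k) : A.charpoly.Monic := by
  unfold charpoly; monicity!

theorem aeval_toMatrix_charpoly (A : Sym3 k) : aeval A.toMatrix A.charpoly = 0 := by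
  simp only [charpoly, map_sub, map_add, map_mul, aeval_X, aeval_C,
    Algebra.algebraMap_eq_smul_one, smul_mul_assoc, one_mul, pow_succ, pow_zero]
  ext i j
  fin_cases i <;> fin_cases j <;>
    simp [toMatrix, tr, minors, det] <;> ring

end CommRing

section Field

variable {k : Type*} [Field k]

theorem HasValue.eq {A : Sym3 k} {x y : k} (hx : A.HasValue x) (hy : A.HasValue y) : x = y := by
  obtain ⟨s, hs, hsv⟩ := hx
  obtain ⟨t, ht, htv⟩ := hy
  obtain rfl : s = t := by
    simp only [IsRankOne, Sym3.addScalar] at hs ht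
    grind
  exact add_right_cancel (hsv.symm.trans htv)

/-- The matrix with rows `w`, `A w`, `A² w`. -/
def krylov (A : Sym3 k) (w : Fin 3 → k) : Matrix (Fin 3) (Fin 3) k :=
  Matrix.of ![w, A.toMatrix *ᵥ w, A.toMatrix *ᵥ (A.toMatrix *ᵥ w)]

theorem det_krylov (A : Sym3 k) (x y z : k) :
    (A.krylov ![x, y, z]).det = A.krylovDet x y z := by
  simp [Matrix.det_fin_three, krylov, krylovDet, toMatrix, dotProduct, Fin.sum_univ_three]
  ring

theorem vecMul_krylov (A : Sym3 k) (w v : Fin 3 → k) :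
    v ᵥ* A.krylov w =
      (v 2 • (A.toMatrix * A.toMatrix) + v 1 • A.toMatrix + v 0 • 1) *ᵥ w := by
  have : v ᵥ* A.krylov w =
      v 0 • w + v 1 • (A.toMatrix *ᵥ w) + v 2 • (A.toMatrix *ᵥ (A.toMatrix *ᵥ w)) := by
    ext i
    simp [krylov, Matrix.vecMul, dotProduct, Fin.sum_univ_three]
  rw [this]
  simp only [Matrix.add_mulVec, Matrix.smul_mulVec, Matrix.one_mulVec, Matrix.mulVec_mulVec]
  abel

theorem eq_zero_of_quad_eq_zero {A : Sym3 k} {w : Fin 3 → k} (hw : (A.krylov w).det ≠ 0)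
    {x y z : k} (h : x • (A.toMatrix * A.toMatrix) + y • A.toMatrix + z • 1 = 0) :
    x = 0 ∧ y = 0 ∧ z = 0 := by
  have h0 : ![z, y, x] ᵥ* A.krylov w = 0 := by
    rw [vecMul_krylov]
    exact (congrArg (· *ᵥ w) h).trans (Matrix.zero_mulVec w)
  have := Matrix.eq_zero_of_vecMul_eq_zero hw h0
  exact ⟨congrFun this 2, congrFun this 1, congrFun this 0⟩

theorem exists_eq_quad {A : Sym3 k} {w : Fin 3 → k} (hw : (A.krylov w).det ≠ 0)
    {B : Matrix (Fin 3) (Fin 3) k} (h : B * A.toMatrix = A.toMatrix * B) :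
    ∃ x y z : k, B = x • (A.toMatrix * A.toMatrix) + y • A.toMatrix + z • 1 := by
  set v := (B *ᵥ w) ᵥ* (A.krylov w)⁻¹ with hv
  refine ⟨v 2, v 1, v 0, sub_eq_zero.1 ?_⟩
  set Q := v 2 • (A.toMatrix * A.toMatrix) + v 1 • A.toMatrix + v 0 • 1 with hQ
  have hQw : Q *ᵥ w = B *ᵥ w := by
    rw [hQ, ← vecMul_krylov, hv, Matrix.vecMul_vecMul, Matrix.nonsing_inv_mul _ hw.isUnit,
      Matrix.vecMul_one]
  have hc : (B - Q) * A.toMatrix = A.toMatrix * (B - Q) := by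
    rw [sub_mul, mul_sub, h, hQ]
    simp [add_mul, mul_add, mul_assoc]
  have h0 : (B - Q) *ᵥ w = 0 := by rw [Matrix.sub_mulVec, hQw, sub_self]
  have h1 : (B - Q) *ᵥ (A.toMatrix *ᵥ w) = 0 := by
    rw [Matrix.mulVec_mulVec, hc, ← Matrix.mulVec_mulVec, h0, Matrix.mulVec_zero]
  have h2 : (B - Q) *ᵥ (A.toMatrix *ᵥ (A.toMatrix *ᵥ w)) = 0 := by
    rw [Matrix.mulVec_mulVec, hc, ← Matrix.mulVec_mulVec, h1, Matrix.mulVec_zero]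
  have hP : A.krylov w * (B - Q)ᵀ = 0 := by
    ext i j
    rw [Matrix.mul_apply_eq_vecMul, Matrix.vecMul_transpose]
    fin_cases i
    · exact congrFun h0 j
    · exact congrFun h1 j
    · exact congrFun h2 j
  have hu : IsUnit (A.krylov w) := (Matrix.isUnit_iff_isUnit_det _).2 hw.isUnit
  exact Matrix.transpose_eq_zero.1 ((hu.mul_right_eq_zero).1 hP)

theorem exists_root {K : Type*} [Field K] [Algebra k K]
    (hK : ∀ q : k[X], q.natDegree = 2 ∨ q.natDegree = 3 → ∃ r : K, aeval r q = 0)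
    {A : Sym3 k} (hA : A.HasRationalPoint ∨ A.HasQuadraticPoint ∨ A.HasCubicPoint) :
    ∃ r : K, aeval r A.charpoly = 0 ∧ ∀ x y z : k, (A.quad x y z).IsRankOne →
      algebraMap k K x * (r * r) + algebraMap k K y * r + algebraMap k K z =
        algebraMap k K (A.quad x y z).value := by
  rcases hA with ⟨r, hr, h⟩ | ⟨r, hr, h⟩ | h
  · refine ⟨algebraMap k K r, ?_, fun x y z hq ↦ ?_⟩
    · rw [aeval_algebraMap_apply]
      unfold IsEigenvalue at hr
      have : aeval r A.charpoly = 0 := by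
        simp [charpoly]
        linear_combination hr
      rw [this, map_zero]
    · rw [← h x y z hq]
      simp
  · obtain ⟨u, hu⟩ := hK (X ^ 2 - C (A.tr - r) * X - C (r * (A.tr - r) - A.minors))
      (.inl (by compute_degree!))
    simp only [map_sub, map_mul, map_pow, aeval_X, aeval_C] at hu
    refine ⟨u, ?_, fun x y z hq ↦ ?_⟩
    · have hr' := congrArg (algebraMap k K) hr
      simp only [map_add, map_mul] at hr'
      simp only [charpoly, map_sub, map_add, map_mul, map_pow, aeval_X, aeval_C]
      linear_combination (u - algebraMap k K r) * hu + hr'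
    · obtain ⟨h₁, h₂⟩ := h x y z hq
      have h₁' := congrArg (algebraMap k K) h₁
      have h₂' := congrArg (algebraMap k K) h₂
      simp only [map_add, map_mul, map_sub, map_zero] at h₁' h₂'
      linear_combination algebraMap k K x * hu + u * h₁' + h₂'
  · obtain ⟨r, hr⟩ := hK A.charpoly (.inr A.natDegree_charpoly)
    refine ⟨r, hr, fun x y z hq ↦ ?_⟩
    obtain ⟨rfl, rfl, hz⟩ := h x y z hq
    simp [← hz]

theorem aeval_eq_zero_of_aeval_toMatrix_eq_zero {K : Type*} [Field K] [Algebra k K] {A : Sym3 k}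
    {w : Fin 3 → k} (hw : (A.krylov w).det ≠ 0) {r : K} (hr : aeval r A.charpoly = 0) {q : k[X]}
    (hq : aeval A.toMatrix q = 0) : aeval r q = 0 := by
  have hdiv := modByMonic_add_div q A.charpoly
  have hrem : aeval A.toMatrix (q %ₘ A.charpoly) = 0 := by
    rw [← hdiv] at hq
    simpa [aeval_toMatrix_charpoly] using hq
  have hdeg : (q %ₘ A.charpoly).natDegree < 3 :=
    (natDegree_modByMonic_lt q A.monic_charpoly fun h ↦ by
      simpa [h] using A.natDegree_charpoly).trans_eq A.natDegree_charpoly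
  have hsum := as_sum_range_C_mul_X_pow' (q %ₘ A.charpoly) hdeg
  generalize q %ₘ A.charpoly = s at *
  rw [hsum] at hrem
  simp only [Finset.sum_range_succ, Finset.sum_range_zero, map_add, map_mul, aeval_C, aeval_X,
    map_pow, Algebra.algebraMap_eq_smul_one, smul_mul_assoc, one_mul] at hrem
  obtain ⟨h₂, h₁, h₀⟩ := eq_zero_of_quad_eq_zero hw (x := s.coeff 2) (y := s.coeff 1)
    (z := s.coeff 0) (by rw [← hrem]; simp [pow_two]; abel)
  have hs : s = 0 := by
    rw [hsum]; simp [Finset.sum_range_succ, h₀, h₁, h₂]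
  rw [← hdiv, hs]
  simp [hr]

/-- `value` extends to a homomorphism on the centralizer of a nondegenerate matrix. -/
theorem exists_centralizer_hom {K : Type*} [Field K] [Algebra k K]
    (hK : ∀ q : k[X], q.natDegree = 2 ∨ q.natDegree = 3 → ∃ r : K, aeval r q = 0)
    {A : Sym3 k} {w : Fin 3 → k} (hw : (A.krylov w).det ≠ 0)
    (hA : A.HasRationalPoint ∨ A.HasQuadraticPoint ∨ A.HasCubicPoint) :
    ∃ φ : Subalgebra.centralizer k {A.toMatrix} →+* K,
      ∀ (B : Subalgebra.centralizer k {A.toMatrix}) (y : k),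
        (ofMatrix (B : Matrix (Fin 3) (Fin 3) k)).HasValue y → φ B = algebraMap k K y := by
  obtain ⟨r, hr, h⟩ := exists_root hK hA
  have hquad (x y z : k) : aeval A.toMatrix (C x * X ^ 2 + C y * X + C z) =
      x • (A.toMatrix * A.toMatrix) + y • A.toMatrix + z • 1 := by
    simp [Algebra.algebraMap_eq_smul_one, pow_two]
  have hmem (q : k[X]) : aeval A.toMatrix q ∈ Subalgebra.centralizer k {A.toMatrix} := by
    rw [Subalgebra.mem_centralizer_iff]
    rintro _ rfl
    simpa using congrArg (aeval A.toMatrix) (mul_comm X q)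
  let ψ : k[X] →ₐ[k] Subalgebra.centralizer k {A.toMatrix} := (aeval A.toMatrix).codRestrict _ hmem
  have hex (B : Subalgebra.centralizer k {A.toMatrix}) : ∃ x y z : k,
      (B : Matrix (Fin 3) (Fin 3) k) =
        x • (A.toMatrix * A.toMatrix) + y • A.toMatrix + z • 1 :=
    exists_eq_quad hw ((Subalgebra.mem_centralizer_iff k).1 B.2 _ rfl).symm
  have hψ : Function.Surjective ψ.toRingHom := fun B ↦ by
    obtain ⟨x, y, z, hB⟩ := hex B
    exact ⟨_, Subtype.ext ((hquad x y z).trans hB.symm)⟩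
  have hker : RingHom.ker ψ.toRingHom ≤ RingHom.ker (aeval r : k[X] →ₐ[k] K).toRingHom :=
    fun q hq ↦ aeval_eq_zero_of_aeval_toMatrix_eq_zero hw hr (congrArg Subtype.val hq)
  refine ⟨ψ.toRingHom.liftOfSurjective hψ ⟨_, hker⟩, fun B v hv ↦ ?_⟩
  obtain ⟨x, y, z, hB⟩ := hex B
  have hBψ : B = ψ.toRingHom (C x * X ^ 2 + C y * X + C z) :=
    Subtype.ext (hB.trans (hquad x y z).symm)
  have hφ : ψ.toRingHom.liftOfSurjective hψ ⟨_, hker⟩ B =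
      algebraMap k K x * (r * r) + algebraMap k K y * r + algebraMap k K z := by
    rw [hBψ, RingHom.liftOfRightInverse_comp_apply]
    simp [pow_two]
  rw [hB, ofMatrix_quad] at hv
  obtain ⟨t, ht, htv⟩ := hv
  rw [quad_addScalar] at ht htv
  have := h x y (z + t) ht
  rw [htv, map_add, map_add] at this
  rw [hφ]
  linear_combination this

end Field

section Hom

variable {k K : Type*} [Field k] [Field K] [Algebra k K]

variable (K) in
/-- The centralizer of a nondegenerate symmetric matrix is commutative, and `value` extends to a
homomorphism on it. -/
theorem AllExtend.centralizer
    (hK : ∀ q : k[X], q.natDegree = 2 ∨ q.natDegree = 3 → ∃ r : K, aeval r q = 0)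
    (he : AllExtend k) {A : Matrix (Fin 3) (Fin 3) k} (hA : Aᵀ = A)
    (hd : ¬(ofMatrix A).IsDegenerate) :
    (∀ X ∈ Subalgebra.centralizer k {A}, ∀ Y ∈ Subalgebra.centralizer k {A}, X * Y = Y * X) ∧
    ∃ φ : Subalgebra.centralizer k {A} →+* K,
      ∀ (B : Subalgebra.centralizer k {A}) (y : k),
        (ofMatrix (B : Matrix (Fin 3) (Fin 3) k)).HasValue y → φ B = algebraMap k K y := by
  set S := (ofMatrix A).addScalar (-(A 2 2)) with hS
  have hAS : A = S.toMatrix + A 2 2 • 1 := by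
    conv_lhs => rw [← toMatrix_ofMatrix hA]
    ext i j
    fin_cases i <;> fin_cases j <;> simp [hS, toMatrix, ofMatrix, addScalar]
  have hcent : Subalgebra.centralizer k {A} = Subalgebra.centralizer k {S.toMatrix} := by
    ext X
    rw [Subalgebra.mem_centralizer_iff, Subalgebra.mem_centralizer_iff, hAS]
    simp [add_mul, mul_add]
  have hext : S.Extends := by
    have := he S.a S.b S.d S.e S.f
    rwa [show (0 : k) = S.c by simp [hS, ofMatrix, addScalar]] at this
  have hSd : ¬S.IsDegenerate := by
    rintro ⟨t, ht⟩
    exact hd ⟨_, by rwa [hS, addScalar_addScalar] at ht⟩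
  obtain ⟨⟨x, y, z, hw⟩, hroot⟩ := hext.resolve_left hSd
  rw [← det_krylov] at hw
  rw [hcent]
  refine ⟨fun X hX Y hY ↦ ?_, exists_centralizer_hom hK hw hroot⟩
  have hX' := (Subalgebra.mem_centralizer_iff k).1 hX _ rfl
  have hY' : S.toMatrix * Y = Y * S.toMatrix := (Subalgebra.mem_centralizer_iff k).1 hY _ rfl
  obtain ⟨x, y, z, rfl⟩ := exists_eq_quad hw hX'.symm
  have hY'' : S.toMatrix * S.toMatrix * Y = Y * (S.toMatrix * S.toMatrix) := by
    rw [mul_assoc, hY', ← mul_assoc, hY', mul_assoc]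
  simp [add_mul, mul_add, hY', hY'']

variable (K) in
/-- There is a function with the prescribed values on degenerate matrices which restricts to a
homomorphism on the centralizer of each nondegenerate one. -/
theorem AllExtend.exists_function
    (hK : ∀ q : k[X], q.natDegree = 2 ∨ q.natDegree = 3 → ∃ r : K, aeval r q = 0)
    (he : AllExtend k) :
    ∃ f : {A : Matrix (Fin 3) (Fin 3) k // Aᵀ = A} → K,
      (∀ A y, (ofMatrix A.1).HasValue y → f A = algebraMap k K y) ∧
      ∀ A : {A : Matrix (Fin 3) (Fin 3) k // Aᵀ = A}, ¬(ofMatrix A.1).IsDegenerate →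
        ∃ φ : Subalgebra.centralizer k {A.1} →+* K,
          ∀ (B : {A : Matrix (Fin 3) (Fin 3) k // Aᵀ = A})
            (hB : B.1 ∈ Subalgebra.centralizer k {A.1}), f B = φ ⟨B.1, hB⟩ := by
  classical
  let P (C : Subalgebra k (Matrix (Fin 3) (Fin 3) k)) (φ : C →+* K) : Prop :=
    ∀ (B : C) (y : k),
      (ofMatrix (B : Matrix (Fin 3) (Fin 3) k)).HasValue y → φ B = algebraMap k K y
  have hΦ : ∀ C : Subalgebra k (Matrix (Fin 3) (Fin 3) k), ∃ Φ : C → K,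
      (∃ φ, P C φ) → ∃ φ, P C φ ∧ Φ = φ := fun C ↦ by
    by_cases h : ∃ φ, P C φ
    · exact ⟨h.choose, fun _ ↦ ⟨_, h.choose_spec, rfl⟩⟩
    · exact ⟨0, fun h' ↦ (h h').elim⟩
  choose Φ hΦ using hΦ
  have hself (A : Matrix (Fin 3) (Fin 3) k) : A ∈ Subalgebra.centralizer k {A} := by
    simp [Subalgebra.mem_centralizer_iff]
  let f (A : {A : Matrix (Fin 3) (Fin 3) k // Aᵀ = A}) : K :=
    if h : (ofMatrix A.1).IsDegenerate then algebraMap k K h.exists_hasValue.choose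
    else Φ _ ⟨A.1, hself A.1⟩
  have hf : ∀ A y, (ofMatrix A.1).HasValue y → f A = algebraMap k K y := fun A y hy ↦ by
    have h := hy.isDegenerate
    simp only [f, dif_pos h, h.exists_hasValue.choose_spec.eq hy]
  refine ⟨f, hf, fun A hA ↦ ?_⟩
  obtain ⟨hcomm, hφ⟩ := he.centralizer K hK A.2 hA
  obtain ⟨φ, hφP, hφ⟩ := hΦ _ hφ
  refine ⟨φ, fun B hB ↦ ?_⟩
  by_cases h : (ofMatrix B.1).IsDegenerate
  · obtain ⟨y, hy⟩ := h.exists_hasValue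
    rw [hf B y hy, hφP _ y hy]
  · have hAB : Subalgebra.centralizer k {B.1} = Subalgebra.centralizer k {A.1} := by
      refine le_antisymm (fun X hX ↦ ?_) fun X hX ↦ ?_
      · rw [Subalgebra.mem_centralizer_iff]
        rintro _ rfl
        refine (he.centralizer K hK B.2 h).1 _ ?_ X hX
        rw [Subalgebra.mem_centralizer_iff]
        rintro _ rfl
        exact ((Subalgebra.mem_centralizer_iff k).1 hB _ rfl).symm
      · rw [Subalgebra.mem_centralizer_iff]
        rintro _ rfl
        exact hcomm _ hB X hX
    have hcongr {C C' : Subalgebra k (Matrix (Fin 3) (Fin 3) k)} (hC : C = C') (hBC : B.1 ∈ C) :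
        Φ C ⟨B.1, hBC⟩ = Φ C' ⟨B.1, hC ▸ hBC⟩ := by
      subst hC; rfl
    simp only [f, dif_neg h]
    rw [hcongr hAB, hφ]

variable (K) in
theorem exists_isSymPartialRingHom
    (hK : ∀ q : k[X], q.natDegree = 2 ∨ q.natDegree = 3 → ∃ r : K, aeval r q = 0)
    (he : AllExtend k) (hc : AllCompatible k) :
    ∃ f : {A : Matrix (Fin 3) (Fin 3) k // Aᵀ = A} → K, IsSymPartialRingHom f := by
  obtain ⟨f, hf, hφ⟩ := he.exists_function K hK
  refine ⟨f, by simpa using hf ⟨0, _⟩ 0 hasValue_zero, by simpa using hf ⟨1, _⟩ 1 hasValue_one,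
    fun A B h ↦ ?_⟩
  set S : {A : Matrix (Fin 3) (Fin 3) k // Aᵀ = A} :=
    ⟨A.1 + B.1, by rw [Matrix.transpose_add, A.2, B.2]⟩ with hS
  set T : {A : Matrix (Fin 3) (Fin 3) k // Aᵀ = A} :=
    ⟨A.1 * B.1, by rw [Matrix.transpose_mul, B.2, A.2]; exact h.symm⟩ with hT
  have key (Z : {A : Matrix (Fin 3) (Fin 3) k // Aᵀ = A})
      (hZ : ¬(ofMatrix Z.1).IsDegenerate) (hA : Z.1 * A.1 = A.1 * Z.1)
      (hB : Z.1 * B.1 = B.1 * Z.1) : f S = f A + f B ∧ f T = f A * f B := by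
    obtain ⟨φ, hφ⟩ := hφ Z hZ
    have hA' : A.1 ∈ Subalgebra.centralizer k {Z.1} := by
      simpa [Subalgebra.mem_centralizer_iff] using hA
    have hB' : B.1 ∈ Subalgebra.centralizer k {Z.1} := by
      simpa [Subalgebra.mem_centralizer_iff] using hB
    rw [hφ A hA', hφ B hB', hφ S (add_mem hA' hB'), hφ T (mul_mem hA' hB'), ← map_add, ← map_mul]
    exact ⟨rfl, rfl⟩
  by_cases hA : (ofMatrix A.1).IsDegenerate
  swap; · exact key A hA rfl h
  by_cases hB : (ofMatrix B.1).IsDegenerate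
  swap; · exact key B hB h.symm rfl
  obtain ⟨a, ha⟩ := hA.exists_hasValue
  obtain ⟨b, hb⟩ := hB.exists_hasValue
  have hcomm : (ofMatrix A.1).Comm (ofMatrix B.1) :=
    comm_of_toMatrix (by rw [toMatrix_ofMatrix A.2, toMatrix_ofMatrix B.2, h])
  constructor
  · by_cases hS' : (ofMatrix S.1).IsDegenerate
    · obtain ⟨c, hc'⟩ := hS'.exists_hasValue
      rw [hf A a ha, hf B b hb, hf S c hc', ← map_add]
      rw [hS, ofMatrix_add] at hc'
      rw [ha.add hc hcomm hb hc']
    · refine (key S hS' ?_ ?_).1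
      · simp [hS, add_mul, mul_add, h]
      · simp [hS, add_mul, mul_add, h]
  · by_cases hT' : (ofMatrix T.1).IsDegenerate
    · obtain ⟨c, hc'⟩ := hT'.exists_hasValue
      rw [hf A a ha, hf B b hb, hf T c hc', ← map_mul]
      have hmul := ofMatrix_toMatrix_mul (ofMatrix A.1) (ofMatrix B.1)
      rw [toMatrix_ofMatrix A.2, toMatrix_ofMatrix B.2] at hmul
      rw [hT, hmul] at hc'
      rw [ha.mul hc hcomm hb hc']
    · refine (key T hT' ?_ ?_).2
      · change A.1 * B.1 * A.1 = A.1 * (A.1 * B.1)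
        rw [mul_assoc, h]
      · change A.1 * B.1 * B.1 = B.1 * (A.1 * B.1)
        rw [← mul_assoc, h]

end Hom

theorem allExtend_zmod_two : AllExtend (ZMod 2) := by
  change AllExtend (Fin 2)
  decide +kernel

theorem allExtend_zmod_three : AllExtend (ZMod 3) := by
  change AllExtend (Fin 3)
  decide +kernel

theorem allCompatible_zmod_two : AllCompatible (ZMod 2) := by
  change AllCompatible (Fin 2)
  decide +kernel

theorem allCompatible_zmod_three : AllCompatible (ZMod 3) := by
  change AllCompatible (Fin 3)
  decide +kernel

end Sym3

/-- A quadratic or cubic polynomial over `𝔽_p` has a root in `𝔽_{p⁶}`. -/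
theorem exists_aeval_galoisField_eq_zero (p : ℕ) [Fact p.Prime] (q : (ZMod p)[X])
    (hq : q.natDegree = 2 ∨ q.natDegree = 3) : ∃ r : GaloisField p 6, aeval r q = 0 := by
  obtain ⟨g, hg, hgq⟩ := exists_irreducible_of_natDegree_ne_zero (f := q) (by omega)
  have : Fact (Irreducible g) := ⟨hg⟩
  have hq0 : q ≠ 0 := by rintro rfl; simp at hq
  have hle := natDegree_le_of_dvd hgq hq0
  have hpos := hg.natDegree_pos
  have hdvd : g.natDegree ∣ 6 := by
    have : g.natDegree ≤ 3 := by omega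
    interval_cases g.natDegree <;> norm_num
  obtain ⟨φ⟩ := FiniteField.nonempty_algHom_of_finrank_dvd (F := ZMod p) (K := AdjoinRoot g)
    (L := GaloisField p 6) (by
      rw [GaloisField.finrank p (by norm_num), (AdjoinRoot.powerBasis hg.ne_zero).finrank,
        AdjoinRoot.powerBasis_dim]
      exact hdvd)
  refine ⟨φ (AdjoinRoot.root g), ?_⟩
  rw [aeval_algHom_apply, AdjoinRoot.aeval_eq, AdjoinRoot.mk_eq_zero.2 hgq, map_zero]

theorem IsSymPartialRingHom.comp_map {R S K : Type*} [CommRing R] [CommRing S] [CommRing K]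
    (g : R →+* S) {f : {A : Matrix (Fin 3) (Fin 3) S // Aᵀ = A} → K}
    (hf : IsSymPartialRingHom f) :
    IsSymPartialRingHom fun A : {A : Matrix (Fin 3) (Fin 3) R // Aᵀ = A} ↦
      f ⟨A.1.map g, by rw [← Matrix.transpose_map, A.2]⟩ := by
  obtain ⟨h0, h1, h⟩ := hf
  refine ⟨?_, ?_, fun A B hAB ↦ ?_⟩
  · simpa using h0
  · simpa using h1
  · have := h ⟨A.1.map g, by rw [← Matrix.transpose_map, A.2]⟩
      ⟨B.1.map g, by rw [← Matrix.transpose_map, B.2]⟩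
      (by simp only [← Matrix.map_mul, hAB])
    simpa only [Matrix.map_add g (map_add g), Matrix.map_mul] using this

/-- The kernel of a morphism of partial rings to a domain is a prime partial ideal. -/
theorem IsSymPartialRingHom.isSymPrimePartialIdeal {R K : Type*} [CommRing R] [CommRing K]
    [IsDomain K] {f : {A : Matrix (Fin 3) (Fin 3) R // Aᵀ = A} → K}
    (hf : IsSymPartialRingHom f) : IsSymPrimePartialIdeal {A | ∃ h : Aᵀ = A, f ⟨A, h⟩ = 0} := by
  obtain ⟨h0, h1, h⟩ := hf
  refine ⟨fun A hA ↦ hA.1, fun C hC hsym ↦ ?_⟩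
  have hC' (x y : C) : x.1 * y.1 = y.1 * x.1 := congrArg Subtype.val (hC x y)
  let φ : C →+* K :=
    { toFun x := f ⟨x.1, hsym x⟩
      map_zero' := h0
      map_one' := h1
      map_add' x y := (h ⟨x.1, hsym x⟩ ⟨y.1, hsym y⟩ (hC' x y)).1
      map_mul' x y := (h ⟨x.1, hsym x⟩ ⟨y.1, hsym y⟩ (hC' x y)).2 }
  exact ⟨RingHom.ker φ, RingHom.ker_isPrime φ, fun x ↦ ⟨fun hx ↦ ⟨hsym x, hx⟩, fun hx ↦ hx.2⟩⟩

theorem exists_isSymPartialRingHom_int_galoisField (p : ℕ) [Fact p.Prime]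
    (he : Sym3.AllExtend (ZMod p)) (hc : Sym3.AllCompatible (ZMod p)) :
    ∃ f : {A : Matrix (Fin 3) (Fin 3) ℤ // Aᵀ = A} → GaloisField p 6, IsSymPartialRingHom f := by
  obtain ⟨f, hf⟩ := Sym3.exists_isSymPartialRingHom (GaloisField p 6)
    (exists_aeval_galoisField_eq_zero p) he hc
  exact ⟨_, hf.comp_map (Int.castRingHom (ZMod p))⟩

/-- For `p = 2` and `p = 3`, there exists a morphism of partial rings from the partial ring
`M₃(ℤ)_sym` of symmetric integer matrices to the finite field `𝔽_{p⁶}`; consequently,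
`M₃(ℤ)_sym` has a prime partial ideal. -/
theorem sym_partial_ring_hom_M3_int_to_GaloisField :
    (∃ f : {A : Matrix (Fin 3) (Fin 3) ℤ // Aᵀ = A} → GaloisField 2 6,
        IsSymPartialRingHom f) ∧
    (∃ f : {A : Matrix (Fin 3) (Fin 3) ℤ // Aᵀ = A} → GaloisField 3 6,
        IsSymPartialRingHom f) ∧
    (∃ p : Set (Matrix (Fin 3) (Fin 3) ℤ), IsSymPrimePartialIdeal p) := by
  have h₂ := exists_isSymPartialRingHom_int_galoisField 2 Sym3.allExtend_zmod_two
    Sym3.allCompatible_zmod_two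
  have h₃ := exists_isSymPartialRingHom_int_galoisField 3 Sym3.allExtend_zmod_three
    Sym3.allCompatible_zmod_three
  exact ⟨h₂, h₃, _, h₂.choose_spec.isSymPrimePartialIdeal⟩
end

section
/- Let α : RingCat ⥤ CommRingCat be a functor, and suppose there is a natural isomorphism between the composite of the inclusion functor CommRingCat ⥤ RingCat with α and the identity functor on CommRingCat. Then for every ring R and every natural number n ≥ 3, the commutative ring α.obj (RingCat.of (Matrix (Fin n) (Fin n) R)) is the zero ring, i.e., its underlying type is a subsingleton. -/
open CategoryTheory

universe u

/-- A map between rings that preserves sums and products of commuting elements. No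
preservation of `1` is required. -/
structure IsCommutingHom {S K : Type*} [Ring S] [Ring K] (f : S → K) : Prop where
  map_add : ∀ {a b : S}, Commute a b → f (a + b) = f a + f b
  map_mul : ∀ {a b : S}, Commute a b → f (a * b) = f a * f b

namespace IsCommutingHom

section Ring

variable {S T K : Type*} [Ring S] [Ring T] [Ring K] {f : S → K}

theorem map_zero (h : IsCommutingHom f) : f 0 = 0 := by
  simpa using h.map_add (Commute.refl (0 : S))

theorem map_sum (h : IsCommutingHom f) {ι : Type*} (s : Finset ι) (x : ι → S)
    (hx : ∀ i j, Commute (x i) (x j)) : f (∑ i ∈ s, x i) = ∑ i ∈ s, f (x i) := by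
  classical
  induction s using Finset.induction_on with
  | empty => simpa using h.map_zero
  | insert i s hi ih =>
    rw [Finset.sum_insert hi, Finset.sum_insert hi,
      h.map_add (Commute.sum_right s x (x i) fun j _ => hx i j), ih]

theorem comp_nonUnitalRingHom (h : IsCommutingHom f) (φ : T →ₙ+* S) :
    IsCommutingHom (f ∘ φ) where
  map_add hab := by simp [h.map_add (hab.map φ)]
  map_mul hab := by simp [h.map_mul (hab.map φ)]

theorem comp_ringHom {L : Type*} [Ring L] (h : IsCommutingHom f) (φ : K →+* L) :
    IsCommutingHom (φ ∘ f) where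
  map_add hab := by simp [h.map_add hab]
  map_mul hab := by simp [h.map_mul hab]

end Ring

open Matrix

section KochenSpecker

variable {K : Type*} [Ring K] {f : Matrix (Fin 3) (Fin 3) ℤ → K}

theorem orthogonal [IsDomain K] (h : IsCommutingHom f) (v φ w ψ : Fin 3 → ℤ)
    (hφw : φ ⬝ᵥ w = 0 := by decide) (hψv : ψ ⬝ᵥ v = 0 := by decide) :
    f (vecMulVec v φ) = 0 ∨ f (vecMulVec w ψ) = 0 := by
  have h0 : vecMulVec v φ * vecMulVec w ψ = 0 := by simp [vecMulVec_mul_vecMulVec, hφw]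
  have h0' : vecMulVec w ψ * vecMulVec v φ = 0 := by simp [vecMulVec_mul_vecMulVec, hψv]
  rw [← mul_eq_zero, ← h.map_mul (h0.trans h0'.symm), h0, h.map_zero]

theorem frame (h : IsCommutingHom f) (h1 : f 1 ≠ 0) (u φ v ψ w χ : Fin 3 → ℤ)
    (huv : vecMulVec u φ * vecMulVec v ψ = vecMulVec v ψ * vecMulVec u φ := by decide)
    (huvw : (vecMulVec u φ + vecMulVec v ψ) * vecMulVec w χ =
      vecMulVec w χ * (vecMulVec u φ + vecMulVec v ψ) := by decide)
    (hsum : vecMulVec u φ + vecMulVec v ψ + vecMulVec w χ = 1 := by decide) :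
    ¬ (f (vecMulVec u φ) = 0 ∧ f (vecMulVec v ψ) = 0 ∧ f (vecMulVec w χ) = 0) := by
  rintro ⟨hu, hv, hw⟩
  apply h1
  rw [← hsum, h.map_add huvw, h.map_add huv, hu, hv, hw, add_zero, add_zero]

/-- A Kochen–Specker theorem for the rank one idempotents of `M₃(ℤ)`. -/
theorem map_vecMulVec_eq_zero [IsDomain K] (h : IsCommutingHom f) :
    f (vecMulVec ![1, 0, 0] ![1, 0, 0]) = 0 := by
  by_contra hne
  have h1 : f 1 ≠ 0 := by
    intro h1
    apply hne
    rw [← one_mul (vecMulVec _ _), h.map_mul (Commute.one_left _), h1, zero_mul]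
  have := h.orthogonal ![0, 0, 1] ![-1, -1, 1] ![1, -1, 0] ![1, 0, 0]
  have := h.orthogonal ![0, 0, 1] ![-1, 0, 1] ![0, 1, 0] ![1, 1, 0]
  have := h.orthogonal ![0, 0, 1] ![-1, 0, 1] ![1, 0, 1] ![1, 1, 0]
  have := h.orthogonal ![0, 0, 1] ![0, 0, 1] ![1, 0, 0] ![1, 0, 0]
  have := h.orthogonal ![0, 1, -1] ![0, 1, 0] ![1, 0, 0] ![1, 0, 0]
  have := h.orthogonal ![0, 1, -1] ![1, 0, -1] ![0, 1, 0] ![-1, 1, 1]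
  have := h.orthogonal ![0, 1, -1] ![1, 0, -1] ![1, 1, 1] ![1, 0, 0]
  have := h.orthogonal ![0, 1, 0] ![-1, 1, 0] ![1, 1, 0] ![1, 0, -1]
  have := h.orthogonal ![0, 1, 0] ![0, 1, -1] ![1, 0, 0] ![1, 0, 0]
  have := h.orthogonal ![0, 1, 0] ![0, 1, 1] ![1, 0, 0] ![1, 0, 0]
  have := h.orthogonal ![0, 1, 0] ![1, 1, 0] ![1, -1, 1] ![1, 0, 0]
  have := h.orthogonal ![0, 1, 1] ![0, 0, 1] ![1, 0, 0] ![1, 0, 0]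
  have := h.orthogonal ![0, 1, 1] ![1, 1, 0] ![1, -1, 1] ![1, 0, 0]
  have := h.orthogonal ![1, -1, -1] ![0, 0, -1] ![1, -1, 0] ![0, -1, 1]
  have := h.orthogonal ![1, -1, -1] ![1, 1, -1] ![1, 0, 1] ![1, 1, 0]
  have := h.orthogonal ![1, -1, 0] ![0, -1, 0] ![1, 0, 0] ![1, 1, -1]
  have := h.orthogonal ![1, -1, 0] ![0, -1, 1] ![1, 0, 0] ![1, 1, 1]
  have := h.orthogonal ![1, 0, -1] ![0, -1, -1] ![1, 0, 0] ![1, 0, 1]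
  have := h.orthogonal ![1, 0, 0] ![1, 1, -1] ![1, 0, 1] ![0, 0, 1]
  have := h.frame h1 ![0, 0, 1] ![-1, -1, 1] ![1, -1, 0] ![0, -1, 0] ![1, 0, 1] ![1, 1, 0]
  have := h.frame h1 ![0, 0, 1] ![-1, 0, 1] ![0, 1, 0] ![-1, 1, 0] ![1, 1, 1] ![1, 0, 0]
  have := h.frame h1 ![0, 0, 1] ![0, 0, 1] ![0, 1, 0] ![1, 1, 0] ![1, -1, 0] ![1, 0, 0]
  have := h.frame h1 ![0, 1, -1] ![0, 1, 0] ![1, 0, -1] ![0, -1, -1] ![1, 0, 0] ![1, 1, 1]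
  have := h.frame h1 ![0, 1, -1] ![1, 0, -1] ![0, 1, 0] ![0, 1, 1] ![1, -1, 1] ![1, 0, 0]
  have := h.frame h1 ![0, 1, 0] ![-1, 1, 1] ![1, 0, 1] ![0, 0, 1] ![1, 1, 0] ![1, 0, -1]
  have := h.frame h1 ![0, 1, 0] ![0, 1, -1] ![1, -1, -1] ![0, 0, -1] ![1, 0, 0] ![1, 0, 1]
  have := h.frame h1 ![0, 1, 1] ![0, 0, 1] ![1, -1, 0] ![0, -1, 1] ![1, 0, 0] ![1, 1, -1]
  have := h.frame h1 ![0, 1, 1] ![1, 1, 0] ![1, -1, -1] ![1, 1, -1] ![1, -1, 0] ![0, -1, 1]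
  grind

end KochenSpecker

section Matrix

variable {R K : Type*} [Ring R]

/-- The non-unital embedding of `M₃(ℤ)` into `Mₙ(R)` as the block indexed by the image of `σ`. -/
def blockHom {n : ℕ} (σ : Fin 3 ↪ Fin n) :
    Matrix (Fin 3) (Fin 3) ℤ →ₙ+* Matrix (Fin n) (Fin n) R where
  toFun A := (1 : Matrix (Fin n) (Fin n) R).submatrix id σ * A.map (Int.castRingHom R) *
    (1 : Matrix (Fin n) (Fin n) R).submatrix σ id
  map_zero' := by simp
  map_add' A B := by
    rw [Matrix.map_add _ (_root_.map_add _), Matrix.mul_add, Matrix.add_mul]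
  map_mul' A B := by
    have key : (1 : Matrix (Fin n) (Fin n) R).submatrix σ id *
        (1 : Matrix (Fin n) (Fin n) R).submatrix id σ = 1 := by
      rw [← submatrix_mul _ _ σ id σ Function.bijective_id, mul_one, submatrix_one _ σ.injective]
    rw [Matrix.map_mul]
    simp only [Matrix.mul_assoc]
    rw [← Matrix.mul_assoc (submatrix 1 σ id), key, Matrix.one_mul]

theorem blockHom_vecMulVec {n : ℕ} (σ : Fin 3 ↪ Fin n) :
    blockHom (R := R) σ (vecMulVec ![1, 0, 0] ![1, 0, 0]) = single (σ 0) (σ 0) 1 := by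
  ext a b
  change ((1 : Matrix (Fin n) (Fin n) R).submatrix id σ *
    (vecMulVec ![1, 0, 0] ![1, 0, 0]).map (Int.castRingHom R) *
    (1 : Matrix (Fin n) (Fin n) R).submatrix σ id) a b = _
  simp [mul_apply, Fin.sum_univ_three, one_apply, single_apply]
  grind

theorem map_one_eq_zero [Ring K] [IsDomain K] {n : ℕ} (hn : 3 ≤ n)
    {f : Matrix (Fin n) (Fin n) R → K} (h : IsCommutingHom f) : f 1 = 0 := by
  rw [← sum_single_one, h.map_sum]
  · refine Finset.sum_eq_zero fun i _ => ?_
    let σ : Fin 3 ↪ Fin n :=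
      (Fin.castLEEmb hn).trans (Equiv.swap (Fin.castLE hn 0) i).toEmbedding
    have hσ : σ 0 = i := by simp [σ]
    have := (h.comp_nonUnitalRingHom (blockHom σ)).map_vecMulVec_eq_zero
    rwa [Function.comp_apply, blockHom_vecMulVec, hσ] at this
  · intro i j
    obtain rfl | hij := eq_or_ne i j
    · exact Commute.refl _
    · exact (single_mul_single_of_ne _ _ _ _ hij _).trans
        (single_mul_single_of_ne _ _ _ _ hij.symm _).symm

end Matrix

end IsCommutingHom

section Functor

open Subring
open scoped IsMulCommutative

variable {α : RingCat.{u} ⥤ CommRingCat.{u}} (η : forget₂ CommRingCat RingCat ⋙ α ≅ 𝟭 CommRingCat)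
  {S : Type u} [Ring S]

/-- The map `C → α(S)` induced by a ring homomorphism `C → S` with `C` commutative. -/
def inducedHom {C : Type u} [CommRing C] (φ : C →+* S) : C →+* α.obj (RingCat.of S) :=
  (η.inv.app (CommRingCat.of C) ≫
    α.map (RingCat.ofHom φ : (forget₂ CommRingCat RingCat).obj (CommRingCat.of C) ⟶ _)).hom

theorem inducedHom_comp {C D : Type u} [CommRing C] [CommRing D] (φ : D →+* S) (g : C →+* D) :
    inducedHom η (φ.comp g) = (inducedHom η φ).comp g := by
  have h : CommRingCat.ofHom g ≫ η.inv.app (CommRingCat.of D) =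
      η.inv.app (CommRingCat.of C) ≫
        α.map ((forget₂ CommRingCat RingCat).map (CommRingCat.ofHom g)) :=
    η.inv.naturality (CommRingCat.ofHom g)
  have h' : (forget₂ CommRingCat RingCat).map (CommRingCat.ofHom g) ≫
      (RingCat.ofHom φ : (forget₂ CommRingCat RingCat).obj (CommRingCat.of D) ⟶ _) =
      RingCat.ofHom (φ.comp g) := rfl
  have key : η.inv.app (CommRingCat.of C) ≫ α.map
        (RingCat.ofHom (φ.comp g) : (forget₂ CommRingCat RingCat).obj (CommRingCat.of C) ⟶ _) =
      CommRingCat.ofHom g ≫ η.inv.app (CommRingCat.of D) ≫ α.map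
        (RingCat.ofHom φ : (forget₂ CommRingCat RingCat).obj (CommRingCat.of D) ⟶ _) := by
    rw [← h', α.map_comp, ← Category.assoc, ← Category.assoc]
    exact congrArg (· ≫ _) h.symm
  exact congrArg CommRingCat.Hom.hom key

/-- The map `S → α(S)` that restricts to the induced homomorphism on every commutative
subring of `S`. -/
def inducedMap (a : S) : α.obj (RingCat.of S) :=
  haveI : IsMulCommutative (closure {a}) := isMulCommutative_closure (by simp)
  inducedHom η (closure {a}).subtype ⟨a, subset_closure rfl⟩

theorem inducedMap_coe (T : Subring S) [IsMulCommutative T] (a : T) :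
    inducedMap η (a : S) = inducedHom η T.subtype a := by
  have : IsMulCommutative (closure {(a : S)}) := isMulCommutative_closure (by simp)
  have hle : closure {(a : S)} ≤ T := by simp [closure_le]
  exact DFunLike.congr_fun (inducedHom_comp η T.subtype (inclusion hle))
    ⟨(a : S), subset_closure rfl⟩

theorem inducedMap_one : inducedMap η (1 : S) = 1 :=
  map_one _

theorem isCommutingHom_inducedMap : IsCommutingHom (inducedMap η (S := S)) := by
  have key {a b : S} (hab : Commute a b) :
      ∃ T : Subring S, IsMulCommutative T ∧ a ∈ T ∧ b ∈ T :=
    ⟨closure {a, b}, isMulCommutative_closure (by simp [hab.eq]),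
      subset_closure (by simp), subset_closure (by simp)⟩
  constructor <;> intro a b hab <;> obtain ⟨T, _, ha, hb⟩ := key hab <;>
    lift a to T using ha <;> lift b to T using hb
  · simp only [← T.coe_add, inducedMap_coe, map_add]
  · simp only [← T.coe_mul, inducedMap_coe, map_mul]

end Functor

/-- If `α : RingCat ⥤ CommRingCat` restricts (along the inclusion of commutative rings) to
the identity functor on `CommRingCat`, then `α` sends `Mₙ(R)` to the zero ring for every
ring `R` and every `n ≥ 3`. -/
theorem abelianization_of_matrix_ring_subsingleton (α : RingCat.{u} ⥤ CommRingCat.{u})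
    (hα : Nonempty (forget₂ CommRingCat RingCat ⋙ α ≅ 𝟭 CommRingCat))
    (R : Type u) [Ring R] (n : ℕ) (hn : 3 ≤ n) :
    Subsingleton ↥(α.obj (RingCat.of (Matrix (Fin n) (Fin n) R))) := by
  obtain ⟨η⟩ := hα
  by_contra hA
  rw [not_subsingleton_iff_nontrivial] at hA
  obtain ⟨m, hm⟩ := Ideal.exists_maximal (α.obj (RingCat.of (Matrix (Fin n) (Fin n) R)))
  have h := (isCommutingHom_inducedMap η).comp_ringHom (Ideal.Quotient.mk m)
  simpa [inducedMap_one] using h.map_one_eq_zero hn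
end

section
/- Let F be a perfect field and K a field extension of F (a field with an Algebra F K structure) such that for every field L with an Algebra F L structure satisfying Module.finrank F L = 2 or Module.finrank F L = 3, there exists an F-algebra homomorphism L →ₐ[F] K. Let A be a partial F-subalgebra of M₃(F): a subset of Matrix (Fin 3) (Fin 3) F containing 0 and 1, closed under scalar multiplication by elements of F, and closed under sums and products of commuting elements of A. If there exists a Kochen–Specker coloring of the idempotents belonging to A, then there exists a morphism of partial F-algebras φ : A → K, i.e., a function φ defined on A with values in K such that φ 0 = 0, φ 1 = 1, φ (t • x) = t • φ x for all t ∈ F and x ∈ A, and φ (x + y) = φ x + φ y and φ (x * y) = φ x * φ y for all x, y ∈ A with x * y = y * x. -/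
universe u

/-- A Kochen–Specker coloring of the idempotents belonging to a subset `A` of a ring `M`. -/
def IsKSColoringIn {M : Type*} [Ring M] (A : Set M)
    (c : {e : M // e ∈ A ∧ e * e = e} → Bool) : Prop :=
  ∀ (k : ℕ) (e : Fin k → {e : M // e ∈ A ∧ e * e = e}),
    (∀ i j : Fin k, i ≠ j → (e i : M) * (e j : M) = 0) →
    ((∀ i j : Fin k, c (e i) = true → c (e j) = true → i = j) ∧
      ((∑ i, (e i : M)) = 1 → ∃! i : Fin k, c (e i) = true))

section

open Polynomial

/-- Fitting decomposition of an element of a commutative Artinian ring. -/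
lemma exists_isIdempotentElem_dvd_isNilpotent {C : Type*} [CommRing C] [IsArtinianRing C] (x : C) :
    ∃ e : C, e * e = e ∧ x ∣ e ∧ IsNilpotent (x * (1 - e)) := by
  obtain ⟨n, y, hy⟩ := IsArtinian.exists_pow_succ_smul_dvd x (1 : C)
  simp only [smul_eq_mul, mul_one, Nat.succ_eq_add_one] at hy
  have key : ∀ k, x ^ (n + 1 + k) * y ^ k = x ^ (n + 1) := by
    intro k
    induction k with
    | zero => simp
    | succ k ih =>
      calc x ^ (n + 1 + (k + 1)) * y ^ (k + 1) = (x ^ (n + 1) * y) * x ^ (k + 1) * y ^ k := by ring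
        _ = x ^ (n + 1 + k) * y ^ k := by rw [hy]; ring
        _ = x ^ (n + 1) := ih
  have h := key (n + 1)
  refine ⟨x ^ (n + 1) * y ^ (n + 1), ?_, ⟨x ^ n * y ^ (n + 1), by ring⟩, n + 1, ?_⟩
  · calc _ = (x ^ (n + 1 + (n + 1)) * y ^ (n + 1)) * y ^ (n + 1) := by ring
      _ = _ := by rw [h]
  · have h0 : x ^ (n + 1) * (1 - x ^ (n + 1) * y ^ (n + 1)) = 0 := by
      linear_combination -h
    rw [mul_pow, pow_succ (1 - _), mul_left_comm, h0, mul_zero]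

/-- A homomorphism from a commutative Artinian ring to a reduced ring has its kernel determined
by its values on idempotents. -/
lemma map_eq_zero_of_forall_idempotent {C K : Type*} [CommRing C] [IsArtinianRing C] [Field K]
    (f g : C →+* K) (hfg : ∀ e : C, e * e = e → f e = 0 → g e = 0) {x : C} (hx : f x = 0) :
    g x = 0 := by
  obtain ⟨e, he, ⟨z, hz⟩, hn⟩ := exists_isIdempotentElem_dvd_isNilpotent x
  have hge : g e = 0 := hfg e he (by rw [hz, map_mul, hx, zero_mul])
  have := (hn.map g).eq_zero
  simpa [hge] using this

/-- A finite field extension of a perfect field in which every element has degree at most three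
embeds in any field containing all extensions of degree two and three. -/
lemma nonempty_algHom_of_natDegree_le {F K L : Type u} [Field F] [PerfectField F] [Field K]
    [Algebra F K]
    (hK : ∀ (L : Type u) [Field L] [Algebra F L],
      (Module.finrank F L = 2 ∨ Module.finrank F L = 3) → Nonempty (L →ₐ[F] K))
    [Field L] [Algebra F L] [FiniteDimensional F L]
    (hL : ∀ x : L, (minpoly F x).natDegree ≤ 3) : Nonempty (L →ₐ[F] K) := by
  obtain ⟨α, hα⟩ := Field.exists_primitive_element F L
  have h := hL α
  rw [(Field.primitive_element_iff_minpoly_natDegree_eq F α).1 hα] at h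
  have hpos : 0 < Module.finrank F L := Module.finrank_pos
  obtain h1 | h23 : Module.finrank F L = 1 ∨
      (Module.finrank F L = 2 ∨ Module.finrank F L = 3) := by omega
  · have hs : Function.Surjective (Algebra.ofId F L) :=
      Algebra.surjective_algebraMap_iff.2 (Subalgebra.bot_eq_top_of_finrank_eq_one h1).symm
    exact ⟨(Algebra.ofId F K).comp
      (AlgEquiv.ofBijective (Algebra.ofId F L) ⟨(algebraMap F L).injective, hs⟩).symm⟩
  · exact hK L h23

/-- If `T` is a multiplicative set in a commutative algebra not containing zero, all of whose
elements are idempotent, there is a homomorphism sending `T` to `1`. -/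
lemma exists_algHom_eq_one {F K C : Type u} [Field F] [PerfectField F] [Field K]
    [Algebra F K]
    (hK : ∀ (L : Type u) [Field L] [Algebra F L],
      (Module.finrank F L = 2 ∨ Module.finrank F L = 3) → Nonempty (L →ₐ[F] K))
    [CommRing C] [Algebra F C] [FiniteDimensional F C]
    (hC : ∀ x : C, (minpoly F x).natDegree ≤ 3)
    (T : Submonoid C) (h0 : (0 : C) ∉ T) (hT : ∀ e ∈ T, e * e = e) :
    ∃ f : C →ₐ[F] K, ∀ e ∈ T, f e = 1 := by
  have : IsArtinianRing C := IsArtinianRing.of_finite F C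
  obtain ⟨P, hP, -, hPT⟩ := Ideal.exists_le_prime_disjoint (⊥ : Ideal C) T (by
    rw [Set.disjoint_left]
    rintro x hx hxT
    obtain rfl : x = 0 := by simpa using hx
    exact h0 hxT)
  have : P.IsMaximal := inferInstance
  let : Field (C ⧸ P) := Ideal.Quotient.field P
  obtain ⟨g⟩ := nonempty_algHom_of_natDegree_le hK (L := C ⧸ P) (by
    intro x
    obtain ⟨y, rfl⟩ := Ideal.Quotient.mkₐ_surjective F P x
    refine (natDegree_le_of_dvd (minpoly.dvd F _ (p := minpoly F y) ?_) ?_).trans (hC y)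
    · rw [aeval_algHom_apply, minpoly.aeval, map_zero]
    · exact minpoly.ne_zero (Algebra.IsIntegral.isIntegral y))
  refine ⟨g.comp (Ideal.Quotient.mkₐ F P), fun e he ↦ ?_⟩
  have hne : g (Ideal.Quotient.mkₐ F P e) ≠ 0 := by
    rw [Ne, map_eq_zero_iff g g.injective]
    simpa [Ideal.Quotient.eq_zero_iff_mem] using fun h ↦ Set.disjoint_left.1 hPT h he
  have h := congrArg (fun z ↦ g (Ideal.Quotient.mkₐ F P z)) (hT e he)
  simp only [map_mul] at h
  exact mul_left_cancel₀ hne (by simpa using h)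

/-- If `F[x]` has a homomorphism taking a non-scalar value at the `3 × 3` matrix `x`, then the
minimal polynomial of `x` has degree three. -/
lemma Matrix.natDegree_minpoly_eq_three {F K : Type*} [Field F] [Field K] [Algebra F K]
    (x : Matrix (Fin 3) (Fin 3) F) (f : Algebra.adjoin F {x} →ₐ[F] K)
    (hf : f ⟨x, Algebra.self_mem_adjoin_singleton F x⟩ ∉ (algebraMap F K).range) :
    (minpoly F x).natDegree = 3 := by
  set y := f ⟨x, Algebra.self_mem_adjoin_singleton F x⟩ with hy
  have hint := Matrix.isIntegral x
  have hdvd : minpoly F y ∣ minpoly F x := by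
    refine minpoly.dvd F _ ?_
    rw [hy, aeval_algHom_apply]
    convert map_zero f
    ext1
    have := minpoly.aeval F x
    rw [← Subalgebra.coe_val, ← aeval_algHom_apply]
    exact this
  have hyint : IsIntegral F y :=
    ⟨minpoly F x, minpoly.monic hint, by
      obtain ⟨q, hq⟩ := hdvd
      rw [← aeval_def, hq, map_mul, minpoly.aeval, zero_mul]⟩
  have hle : (minpoly F x).natDegree ≤ 3 := by
    have := natDegree_le_of_dvd (Matrix.minpoly_dvd_charpoly x) (Matrix.charpoly_monic x).ne_zero
    simpa [Matrix.charpoly_natDegree_eq_dim] using this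
  have h2 : 2 ≤ (minpoly F y).natDegree := by
    have h1 : (minpoly F y).natDegree ≠ 1 := fun h ↦ hf (minpoly.natDegree_eq_one_iff.1 h)
    have := minpoly.natDegree_pos hyint
    omega
  have hle' := natDegree_le_of_dvd hdvd (minpoly.ne_zero hint)
  by_contra hne
  have hdx : (minpoly F x).natDegree = (minpoly F y).natDegree := by omega
  have heq : minpoly F y = minpoly F x :=
    (eq_of_monic_of_dvd_of_natDegree_le (minpoly.monic hyint) (minpoly.monic hint) hdvd
      hdx.le).symm
  have hdvd2 := heq ▸ Matrix.minpoly_dvd_charpoly x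
  obtain ⟨q, hq⟩ := hdvd2
  have hq0 : q ≠ 0 := by
    rintro rfl
    exact (Matrix.charpoly_monic x).ne_zero (by simpa using hq)
  have hqd : q.natDegree = 1 := by
    have := congrArg natDegree hq
    rw [natDegree_mul (minpoly.ne_zero hyint) hq0, Matrix.charpoly_natDegree_eq_dim,
      Fintype.card_fin] at this
    omega
  obtain ⟨a, ha⟩ := exists_root_of_degree_eq_one (degree_eq_iff_natDegree_eq hq0 |>.2 hqd)
  have hev : Module.End.HasEigenvalue (Matrix.toLin' x) a := by
    rw [Module.End.hasEigenvalue_iff_isRoot_charpoly, Matrix.charpoly_toLin', hq]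
    exact root_mul_left_of_isRoot _ ha
  have hroot := Module.End.isRoot_of_hasEigenvalue hev
  rw [Matrix.minpoly_toLin', ← heq] at hroot
  have := degree_eq_one_of_irreducible_of_root (minpoly.irreducible hyint) hroot
  have h1 : (minpoly F y).natDegree = 1 := natDegree_eq_of_degree_eq_some this
  omega

/-- An endomorphism whose minimal polynomial has maximal degree has a cyclic vector. -/
lemma Module.End.exists_cyclic_vector {F V : Type*} [Field F] [AddCommGroup V] [Module F V]
    [FiniteDimensional F V] (φ : Module.End F V)
    (hφ : (minpoly F φ).natDegree = Module.finrank F V) :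
    ∃ v : V, ∀ w : V, ∃ p : F[X], aeval φ p v = w := by
  obtain ⟨v, hv⟩ := Module.exists_ker_toSpanSingleton_eq_annihilator F[X] (Module.AEval' φ)
  obtain ⟨v, rfl⟩ := (Module.AEval'.of φ).surjective v
  rw [← span_minpoly_eq_annihilator] at hv
  let ev : degreeLT F (Module.finrank F V) →ₗ[F] V :=
    (LinearMap.applyₗ v ∘ₗ (aeval φ).toLinearMap) ∘ₗ (degreeLT F (Module.finrank F V)).subtype
  have hinj : Function.Injective ev := by
    rw [injective_iff_map_eq_zero]
    rintro ⟨p, hp⟩ h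
    have h' : aeval φ p v = 0 := h
    have hmem : p ∈ LinearMap.ker (LinearMap.toSpanSingleton F[X] _ (Module.AEval'.of φ v)) := by
      rw [LinearMap.mem_ker, LinearMap.toSpanSingleton_apply]
      exact h'
    rw [hv, Ideal.mem_span_singleton] at hmem
    ext1
    refine eq_zero_of_dvd_of_degree_lt hmem ?_
    rw [degree_eq_natDegree (minpoly.ne_zero (Algebra.IsIntegral.isIntegral φ)), hφ]
    exact mem_degreeLT.1 hp
  have hdim : Module.finrank F (degreeLT F (Module.finrank F V)) = Module.finrank F V := by
    rw [(degreeLTEquiv F _).finrank_eq, Module.finrank_fin_fun]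
  have : FiniteDimensional F (degreeLT F (Module.finrank F V)) :=
    Module.Finite.equiv (degreeLTEquiv F _).symm
  have hsurj := (LinearMap.injective_iff_surjective_of_finrank_eq_finrank hdim).1 hinj
  refine ⟨v, fun w ↦ ?_⟩
  obtain ⟨p, hp⟩ := hsurj w
  exact ⟨p, hp⟩

/-- A matrix whose minimal polynomial has maximal degree generates its own centralizer. -/
lemma Matrix.mem_adjoin_of_commute {F n : Type*} [Field F] [Fintype n] [DecidableEq n]
    (x y : Matrix n n F) (hx : (minpoly F x).natDegree = Fintype.card n)
    (hxy : Commute x y) : y ∈ Algebra.adjoin F {x} := by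
  let e : Matrix n n F ≃ₐ[F] Module.End F (n → F) := Matrix.toLinAlgEquiv'
  have hcomm : ∀ p : F[X], Commute (aeval (e x) p) (e y) := fun p ↦ by
    rw [aeval_algHom_apply]
    refine Commute.map ?_ e
    induction p using Polynomial.induction_on' with
    | add p q hp hq => rw [map_add]; exact hp.add_left hq
    | monomial k a =>
      rw [aeval_monomial]
      exact Commute.mul_left (Algebra.commutes a y) (hxy.pow_left k)
  obtain ⟨v, hv⟩ := Module.End.exists_cyclic_vector (e x) (by
    rw [Module.finrank_fintype_fun_eq_card, ← hx, ← minpoly.algEquiv_eq e x])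
  obtain ⟨p, hp⟩ := hv (e y v)
  have hey : e y = e (aeval x p) := by
    rw [← aeval_algHom_apply]
    refine LinearMap.ext fun w ↦ ?_
    obtain ⟨r, rfl⟩ := hv w
    calc e y (aeval (e x) r v) = aeval (e x) r (e y v) :=
          (congrArg (fun g : Module.End F (n → F) ↦ g v) (hcomm r).eq).symm
      _ = aeval (e x) r (aeval (e x) p v) := by rw [hp]
      _ = aeval (e x) p (aeval (e x) r v) := by
          rw [← Module.End.mul_apply, ← Module.End.mul_apply, ← map_mul, ← map_mul, mul_comm]
  rw [e.injective hey]
  exact aeval_mem_adjoin_singleton F x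

/-- The idempotents colored `true` are closed under commuting products and contain exactly one of
each complementary pair. -/
lemma IsKSColoringIn.exists_pred {M : Type*} [Ring M] {A : Set M}
    {c : {e : M // e ∈ A ∧ e * e = e} → Bool} (hc : IsKSColoringIn A c)
    (h1 : 1 ∈ A) (hsub : ∀ e ∈ A, 1 - e ∈ A)
    (hmul : ∀ x ∈ A, ∀ y ∈ A, x * y = y * x → x * y ∈ A) :
    ∃ P : M → Prop, P 1 ∧ ¬ P 0 ∧ (∀ e, P e → e * e = e) ∧
      (∀ e ∈ A, e * e = e → P e ∨ P (1 - e)) ∧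
      ∀ e f, P e → P f → e * f = f * e → P (e * f) := by
  let P : M → Prop := fun e ↦ ∃ h : e ∈ A ∧ e * e = e, c ⟨e, h⟩ = true
  have hsub' : ∀ e, e ∈ A ∧ e * e = e → 1 - e ∈ A ∧ (1 - e) * (1 - e) = 1 - e :=
    fun e h ↦ ⟨hsub e h.1, by rw [mul_sub, sub_mul, sub_mul, h.2]; simp⟩
  have hdisj : ∀ e f, P e → P f → e * f = 0 → f * e = 0 → False := by
    rintro e f ⟨he, hce⟩ ⟨hf, hcf⟩ hef hfe
    have h := (hc 2 ![⟨e, he⟩, ⟨f, hf⟩] (by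
      intro i j hij
      fin_cases i <;> fin_cases j <;> simp_all)).1 0 1 hce hcf
    exact absurd h (by decide)
  have hor : ∀ e, e ∈ A ∧ e * e = e → P e ∨ P (1 - e) := by
    intro e he
    obtain ⟨i, hi, -⟩ := (hc 2 ![⟨e, he⟩, ⟨1 - e, hsub' e he⟩] (by
      intro i j hij
      fin_cases i <;> fin_cases j <;> simp_all [mul_sub, sub_mul])).2 (by simp)
    fin_cases i
    · exact Or.inl ⟨_, hi⟩
    · exact Or.inr ⟨_, hi⟩
  have hP0 : ¬ P 0 := fun h ↦ hdisj 0 0 h h (by simp) (by simp)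
  refine ⟨P, ?_, hP0, fun e h ↦ h.1.2, fun e h h' ↦ hor e ⟨h, h'⟩, ?_⟩
  · exact (hor 1 ⟨h1, by simp⟩).resolve_right (by simpa using hP0)
  · intro e f hPe hPf hef
    have he := hPe.1
    have hf := hPf.1
    have he' := hsub' e he
    have hf' := hsub' f hf
    have hcomm : ∀ a b : M, a * b = b * a → a * a = a → b * b = b →
        (a * b) * (a * b) = a * b := fun a b h ha hb ↦ by
      rw [mul_assoc, ← mul_assoc b, ← h, mul_assoc a b b, hb, ← mul_assoc, ha]
    have hef' : e * (1 - f) = (1 - f) * e := by rw [mul_sub, sub_mul, hef]; simp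
    have hef1 : e * f ∈ A ∧ e * f * (e * f) = e * f :=
      ⟨hmul e he.1 f hf.1 hef, hcomm e f hef he.2 hf.2⟩
    have hef2 : e * (1 - f) ∈ A ∧ e * (1 - f) * (e * (1 - f)) = e * (1 - f) :=
      ⟨hmul e he.1 _ hf'.1 hef', hcomm e _ hef' he.2 hf'.2⟩
    have hfz : f * (1 - f) = 0 := by rw [mul_sub, hf.2]; simp
    have hfz' : (1 - f) * f = 0 := by rw [sub_mul, hf.2]; simp
    have hez : e * (1 - e) = 0 := by rw [mul_sub, he.2]; simp
    have hez' : (1 - e) * e = 0 := by rw [sub_mul, he.2]; simp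
    have hx1 : e * f * (e * (1 - f)) = 0 := by
      rw [hef', mul_assoc, ← mul_assoc f, hfz]; simp
    have hx2 : e * (1 - f) * (e * f) = 0 := by
      rw [hef, mul_assoc, ← mul_assoc (1 - f), hfz']; simp
    have hx3 : e * f * (1 - e) = 0 := by rw [hef, mul_assoc, hez, mul_zero]
    have hx4 : (1 - e) * (e * f) = 0 := by rw [← mul_assoc, hez', zero_mul]
    have hx5 : e * (1 - f) * (1 - e) = 0 := by rw [hef', mul_assoc, hez, mul_zero]
    have hx6 : (1 - e) * (e * (1 - f)) = 0 := by rw [← mul_assoc, hez', zero_mul]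
    obtain ⟨i, hi, -⟩ := (hc 3 ![⟨e * f, hef1⟩, ⟨e * (1 - f), hef2⟩, ⟨1 - e, he'⟩] (by
      intro i j hij
      fin_cases i <;> fin_cases j
      exacts [absurd rfl hij, hx1, hx3, hx2, absurd rfl hij, hx5, hx4, hx6,
        absurd rfl hij])).2 (by simp [Fin.sum_univ_three, mul_sub])
    fin_cases i
    · exact ⟨_, hi⟩
    · exact (hdisj _ f ⟨hef2, hi⟩ hPf (by rw [mul_assoc, hfz', mul_zero])
        (by rw [hef', ← mul_assoc, hfz, zero_mul])).elim
    · exact (hdisj _ e ⟨he', hi⟩ hPe hez' hez).elim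

/-- Any homomorphism from `F[x]` taking a non-scalar value at `x` forces the centralizer of the
`3 × 3` matrix `x` to be `F[x]`. -/
lemma Matrix.mem_adjoin_of_commute_of_notMem_range {F K : Type*} [Field F] [Field K] [Algebra F K]
    (x y : Matrix (Fin 3) (Fin 3) F) (f : Algebra.adjoin F {x} →ₐ[F] K)
    (hf : f ⟨x, Algebra.self_mem_adjoin_singleton F x⟩ ∉ (algebraMap F K).range)
    (hxy : Commute x y) : y ∈ Algebra.adjoin F {x} :=
  x.mem_adjoin_of_commute y (by simpa using x.natDegree_minpoly_eq_three f hf) hxy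

open scoped IsMulCommutative in
/-- A commutative algebra of `3 × 3` matrices has a homomorphism to `K` sending the idempotents
selected by `P` to `1`. -/
lemma Matrix.exists_algHom_adapted {F K : Type u} [Field F] [PerfectField F] [Field K]
    [Algebra F K]
    (hK : ∀ (L : Type u) [Field L] [Algebra F L],
      (Module.finrank F L = 2 ∨ Module.finrank F L = 3) → Nonempty (L →ₐ[F] K))
    {P : Matrix (Fin 3) (Fin 3) F → Prop} (hP1 : P 1) (hP0 : ¬ P 0) (hPe : ∀ e, P e → e * e = e)
    (hPm : ∀ e f, P e → P f → e * f = f * e → P (e * f))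
    (C : Subalgebra F (Matrix (Fin 3) (Fin 3) F)) [IsMulCommutative C] :
    ∃ f : C →ₐ[F] K, ∀ e : C, P e → f e = 1 := by
  let T : Submonoid C :=
    { carrier := {e | P e}
      one_mem' := hP1
      mul_mem' := fun {a b} ha hb ↦ hPm a b ha hb (congrArg Subtype.val (mul_comm' a b)) }
  obtain ⟨f, hf⟩ := exists_algHom_eq_one hK (C := C) (fun x ↦ by
    rw [← minpoly.algHom_eq C.val Subtype.val_injective x]
    have := natDegree_le_of_dvd (Matrix.minpoly_dvd_charpoly (C.val x))
      (Matrix.charpoly_monic _).ne_zero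
    simpa [Matrix.charpoly_natDegree_eq_dim] using this) T hP0
    (fun e he ↦ Subtype.ext (hPe e he))
  exact ⟨f, hf⟩

open scoped IsMulCommutative in
/-- Homomorphisms sending the same idempotents to `1` agree where they take scalar values. -/
lemma AlgHom.apply_eq_algebraMap_of_adapted {F K M : Type*} [Field F] [Field K] [Algebra F K]
    [Ring M] [Algebra F M] {P : M → Prop} (C : Subalgebra F M) [IsMulCommutative C]
    [FiniteDimensional F C] (hP : ∀ e : C, e * e = e → P e ∨ P (1 - e))
    (f g : C →ₐ[F] K) (hf : ∀ e : C, P e → f e = 1) (hg : ∀ e : C, P e → g e = 1)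
    {x : C} {a : F} (hx : f x = algebraMap F K a) : g x = algebraMap F K a := by
  have : IsArtinianRing C := IsArtinianRing.of_finite F C
  have h := map_eq_zero_of_forall_idempotent f.toRingHom g.toRingHom (fun e he hfe ↦ by
    rcases hP e he with h | h
    · exact absurd ((hf e h).symm.trans hfe) one_ne_zero
    · have := hg (1 - e) h
      rw [map_sub, map_one] at this
      simpa using this) (x := x - algebraMap F C a)
      (by simp [hx])
  simpa [sub_eq_zero] using h

end

/-- Let `F` be a perfect field and `K` a field extension of `F` containing a copy of every
degree-two and degree-three extension of `F`, and let `A` be a partial `F`-subalgebra of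
`M₃(F)`. If there is a Kochen–Specker coloring of the idempotents belonging to `A`, then
there exists a morphism of partial `F`-algebras `A → K`. -/
theorem partial_algebra_hom_of_KS_coloring
    (F : Type u) [Field F] [PerfectField F]
    (K : Type u) [Field K] [Algebra F K]
    (hK : ∀ (L : Type u) [Field L] [Algebra F L],
      (Module.finrank F L = 2 ∨ Module.finrank F L = 3) → Nonempty (L →ₐ[F] K))
    (A : Set (Matrix (Fin 3) (Fin 3) F))
    (h0 : (0 : Matrix (Fin 3) (Fin 3) F) ∈ A)
    (h1 : (1 : Matrix (Fin 3) (Fin 3) F) ∈ A)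
    (hsmul : ∀ (t : F) (x : Matrix (Fin 3) (Fin 3) F), x ∈ A → t • x ∈ A)
    (hadd : ∀ x y : Matrix (Fin 3) (Fin 3) F, x ∈ A → y ∈ A → x * y = y * x → x + y ∈ A)
    (hmul : ∀ x y : Matrix (Fin 3) (Fin 3) F, x ∈ A → y ∈ A → x * y = y * x → x * y ∈ A)
    (hc : ∃ c : {e : Matrix (Fin 3) (Fin 3) F // e ∈ A ∧ e * e = e} → Bool,
      IsKSColoringIn A c) :
    ∃ φ : A → K,
      φ ⟨0, h0⟩ = 0 ∧
      φ ⟨1, h1⟩ = 1 ∧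
      (∀ (t : F) (x : A), φ ⟨t • (x : Matrix (Fin 3) (Fin 3) F), hsmul t x x.2⟩ = t • φ x) ∧
      (∀ (x y : A) (h : (x : Matrix (Fin 3) (Fin 3) F) * y =
          (y : Matrix (Fin 3) (Fin 3) F) * x),
        φ ⟨(x : Matrix (Fin 3) (Fin 3) F) + y, hadd x y x.2 y.2 h⟩ = φ x + φ y ∧
        φ ⟨(x : Matrix (Fin 3) (Fin 3) F) * y, hmul x y x.2 y.2 h⟩ = φ x * φ y) := by
  obtain ⟨c, hc⟩ := hc
  have hsub : ∀ e ∈ A, 1 - e ∈ A := fun e he ↦ by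
    have := hadd 1 ((-1 : F) • e) h1 (hsmul _ _ he) (by simp)
    simpa [sub_eq_add_neg] using this
  obtain ⟨P, hP1, hP0, hPe, hPor, hPm⟩ :=
    hc.exists_pred h1 hsub (fun x hx y hy ↦ hmul x y hx hy)
  choose σ hσ using fun (C : Subalgebra F (Matrix (Fin 3) (Fin 3) F)) (h : IsMulCommutative C) ↦
    Matrix.exists_algHom_adapted hK hP1 hP0 hPe hPm C
  let φ : Matrix (Fin 3) (Fin 3) F → K := fun x ↦ σ (Algebra.adjoin F {x}) inferInstance
    ⟨x, Algebra.self_mem_adjoin_singleton F x⟩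
  -- On a commutative subalgebra, `φ` agrees with any adapted homomorphism at scalar values.
  have hφ : ∀ (C : Subalgebra F (Matrix (Fin 3) (Fin 3) F)), IsMulCommutative C →
      (C : Set (Matrix (Fin 3) (Fin 3) F)) ⊆ A → ∀ ψ : C →ₐ[F] K, (∀ e : C, P e → ψ e = 1) →
      ∀ z : C, φ z ∈ (algebraMap F K).range → φ z = ψ z := by
    rintro C hC hCA ψ hψ z ⟨a, ha⟩
    have hle : Algebra.adjoin F {(z : Matrix (Fin 3) (Fin 3) F)} ≤ C :=
      Algebra.adjoin_le (by simp)
    have := AlgHom.apply_eq_algebraMap_of_adapted (P := P)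
      (Algebra.adjoin F {(z : Matrix (Fin 3) (Fin 3) F)})
      (fun e he ↦ hPor e (hCA (hle e.2)) (congrArg Subtype.val he)) (σ _ inferInstance)
      (ψ.comp (Subalgebra.inclusion hle)) (hσ _ _) (fun e he ↦ hψ (Subalgebra.inclusion hle e) he)
      ha.symm
    exact ha.symm.trans this.symm
  have key : ∀ (C : Subalgebra F (Matrix (Fin 3) (Fin 3) F)), IsMulCommutative C →
      (C : Set (Matrix (Fin 3) (Fin 3) F)) ⊆ A → ∃ ψ : C →ₐ[F] K, ∀ z : C, φ z = ψ z := by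
    intro C hC hCA
    have hgen : ∀ z : C, φ z ∉ (algebraMap F K).range →
        Algebra.adjoin F {(z : Matrix (Fin 3) (Fin 3) F)} = C := fun z hz ↦
      le_antisymm (Algebra.adjoin_le (by simp)) fun y hy ↦
        Matrix.mem_adjoin_of_commute_of_notMem_range _ y _ hz
          (congrArg Subtype.val (mul_comm' z ⟨y, hy⟩))
    refine ⟨σ C hC, fun z ↦ ?_⟩
    by_cases hz : φ z ∈ (algebraMap F K).range
    · exact hφ C hC hCA _ (hσ C hC) z hz
    · have hσeq : ∀ (D : Subalgebra F (Matrix (Fin 3) (Fin 3) F)) (hD : IsMulCommutative D)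
          (hzD : (z : Matrix (Fin 3) (Fin 3) F) ∈ D), D = C → σ D hD ⟨z, hzD⟩ = σ C hC z := by
        rintro D hD hzD rfl
        rfl
      exact hσeq _ _ _ (hgen z hz)
  have hadj : ∀ x ∈ A, ∀ y ∈ A, x * y = y * x →
      ∃ (C : Subalgebra F (Matrix (Fin 3) (Fin 3) F)) (ψ : C →ₐ[F] K) (_ : x ∈ C) (_ : y ∈ C),
        ∀ z : C, φ z = ψ z := by
    intro x hx y hy hxy
    have hcomm : IsMulCommutative (Algebra.adjoin F {x, y}) :=
      Algebra.isMulCommutative_adjoin F (by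
        rintro a (rfl | rfl) b (rfl | rfl) <;> first | rfl | exact hxy | exact hxy.symm)
    obtain ⟨ψ, hψ⟩ := key _ hcomm (fun z hz ↦ by
      induction hz using Algebra.adjoin_induction with
      | mem z hz => rcases hz with rfl | rfl <;> assumption
      | algebraMap r => rw [Algebra.algebraMap_eq_smul_one]; exact hsmul r 1 h1
      | add a b ha hb iha ihb =>
        exact hadd a b iha ihb (congrArg Subtype.val
          (mul_comm' (⟨a, ha⟩ : Algebra.adjoin F {x, y}) ⟨b, hb⟩))
      | mul a b ha hb iha ihb =>
        exact hmul a b iha ihb (congrArg Subtype.val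
          (mul_comm' (⟨a, ha⟩ : Algebra.adjoin F {x, y}) ⟨b, hb⟩)))
    exact ⟨_, ψ, Algebra.subset_adjoin (by simp), Algebra.subset_adjoin (by simp), hψ⟩
  clear_value φ
  refine ⟨fun x ↦ φ x, ?_, ?_, fun t x ↦ ?_, fun x y h ↦ ⟨?_, ?_⟩⟩
  · obtain ⟨C, ψ, -, -, hψ⟩ := hadj 0 h0 0 h0 rfl
    simpa using hψ 0
  · obtain ⟨C, ψ, -, -, hψ⟩ := hadj 1 h1 1 h1 rfl
    simpa using hψ 1
  · obtain ⟨C, ψ, hx, -, hψ⟩ := hadj x x.2 x x.2 rfl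
    calc φ (t • x) = ψ (t • (⟨x, hx⟩ : C)) := hψ (t • (⟨x, hx⟩ : C))
      _ = t • φ x := by rw [map_smul, ← hψ]
  · obtain ⟨C, ψ, hx, hy, hψ⟩ := hadj x x.2 y y.2 h
    calc φ (x + y) = ψ ((⟨x, hx⟩ : C) + (⟨y, hy⟩ : C)) := hψ ((⟨x, hx⟩ : C) + (⟨y, hy⟩ : C))
      _ = φ x + φ y := by rw [map_add, ← hψ, ← hψ]
  · obtain ⟨C, ψ, hx, hy, hψ⟩ := hadj x x.2 y y.2 h
    calc φ (x * y) = ψ ((⟨x, hx⟩ : C) * (⟨y, hy⟩ : C)) := hψ ((⟨x, hx⟩ : C) * (⟨y, hy⟩ : C))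
      _ = φ x * φ y := by rw [map_mul, ← hψ, ← hψ]
end
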